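/- arXiv:2106.03509 — 8 statements merged into one kernel-verified Lean document; each statement's English description precedes it below -/
import Mathlib

section
/- For every integer n ≥ 6, one has α^{n−2} ≤ F_n − 11·α^{−n} and F_n + 11·α^{−n} ≤ α^{n−1}. -/
open Real

/-- The golden ratio α = (1+√5)/2. -/
noncomputable def alpha : ℝ := (1 + Real.sqrt 5) / 2

/-- The Lucas sequence: L 0 = 2, L 1 = 1, L (n+2) = L (n+1) + L n. -/
def lucas : ℕ → ℤ
  | 0 => 2
  | 1 => 1
  | n + 2 => lucas (n + 1) + lucas n

/-- The cubic polynomial f_n(X) = (X − F_n)(X − L_n)X − 1. -/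
noncomputable def fpoly (n : ℕ) (X : ℝ) : ℝ :=
  (X - (Nat.fib n : ℝ)) * (X - (lucas n : ℝ)) * X - 1

theorem alpha_sq : alpha ^ 2 = alpha + 1 := by
  have h5 : Real.sqrt 5 ^ 2 = 5 := Real.sq_sqrt (by norm_num)
  unfold alpha
  linarith

theorem alpha_gt : 1.618 < alpha := by
  have h : (2.236 : ℝ) < Real.sqrt 5 := Real.lt_sqrt_of_sq_lt (by norm_num)
  unfold alpha
  linarith

theorem alpha_lt : alpha < 1.619 := by
  have h : Real.sqrt 5 < 2.238 := (Real.sqrt_lt' (by norm_num)).2 (by norm_num)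
  unfold alpha
  linarith

theorem alpha_inv : alpha⁻¹ = alpha - 1 := by
  refine inv_eq_of_mul_eq_one_right ?_
  linear_combination alpha_sq

theorem fib_alpha_bounds_shifted (m : ℕ) :
    alpha ^ (m + 4) ≤ (Nat.fib (m + 6) : ℝ) - 11 * (alpha - 1) ^ (m + 6) ∧
    (Nat.fib (m + 6) : ℝ) + 11 * (alpha - 1) ^ (m + 6) ≤ alpha ^ (m + 5) := by
  have hs := alpha_sq
  have hl := alpha_gt
  have hu := alpha_lt
  have h4 : alpha ^ 4 = 3 * alpha + 2 := by linear_combination (alpha ^ 2 + alpha + 2) * hs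
  have h5 : alpha ^ 5 = 5 * alpha + 3 := by linear_combination alpha * h4 + 3 * hs
  have h6 : alpha ^ 6 = 8 * alpha + 5 := by linear_combination alpha * h5 + 5 * hs
  have hb : (alpha - 1) ^ 2 = 2 - alpha := by linear_combination hs
  have hb4 : (alpha - 1) ^ 4 = 5 - 3 * alpha := by
    linear_combination ((alpha - 1) ^ 2 + (2 - alpha)) * hb + hs
  have hb6 : (alpha - 1) ^ 6 = 13 - 8 * alpha := by
    linear_combination (alpha - 1) ^ 2 * hb4 + (5 - 3 * alpha) * hb + 3 * hs
  have hb7 : (alpha - 1) ^ 7 = 13 * alpha - 21 := by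
    linear_combination (alpha - 1) * hb6 - 8 * hs
  induction m using Nat.twoStepInduction with
  | zero =>
    norm_num [Nat.fib_add_two, h4, h5, hb6]
    constructor <;> linarith
  | one =>
    norm_num [Nat.fib_add_two, h5, h6, hb7]
    constructor <;> linarith
  | more m ih₀ ih₁ =>
    have hfib : (Nat.fib (m + 2 + 6) : ℝ) = Nat.fib (m + 6) + Nat.fib (m + 1 + 6) := by
      exact_mod_cast Nat.fib_add_two (n := m + 6)
    have hpow₄ : alpha ^ (m + 2 + 4) = alpha ^ (m + 4) + alpha ^ (m + 1 + 4) := by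
      linear_combination alpha ^ (m + 4) * hs
    have hpow₅ : alpha ^ (m + 2 + 5) = alpha ^ (m + 5) + alpha ^ (m + 1 + 5) := by
      linear_combination alpha ^ (m + 5) * hs
    have hle : (alpha - 1) ^ (m + 2 + 6) ≤ (alpha - 1) ^ (m + 6) :=
      pow_le_pow_of_le_one (by linarith) (by linarith) (by omega)
    have hpos : 0 ≤ (alpha - 1) ^ (m + 1 + 6) := pow_nonneg (by linarith) _
    rw [hfib, hpow₄, hpow₅]
    constructor <;> linarith [ih₀.1, ih₀.2, ih₁.1, ih₁.2]

theorem fib_alpha_bounds (n : ℕ) (hn : 6 ≤ n) :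
    alpha ^ ((n : ℤ) - 2) ≤ (Nat.fib n : ℝ) - 11 * alpha ^ (-(n : ℤ)) ∧
    (Nat.fib n : ℝ) + 11 * alpha ^ (-(n : ℤ)) ≤ alpha ^ ((n : ℤ) - 1) := by
  obtain ⟨m, rfl⟩ := Nat.exists_eq_add_of_le' hn
  have h₂ : ((m + 6 : ℕ) : ℤ) - 2 = (m + 4 : ℕ) := by omega
  have h₁ : ((m + 6 : ℕ) : ℤ) - 1 = (m + 5 : ℕ) := by omega
  rw [h₂, h₁, zpow_neg, zpow_natCast, zpow_natCast, zpow_natCast, ← inv_pow, alpha_inv]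
  exact fib_alpha_bounds_shifted m
end

section
/- For every integer n ≥ 10, the cubic polynomial f_n(X) = (X − F_n)(X − L_n)X − 1 has exactly three real roots r_3 < r_1 < r_2, and these satisfy |r_1 − F_n| ≤ 6·α^{−2n}, |r_2 − L_n| ≤ 4·α^{−2n}, and |r_3 − √5·α^{−2n}| ≤ α^{−4n}. -/
open Real

theorem alpha_eq_goldenRatio : alpha = goldenRatio := rfl

theorem coe_lucas_eq (n : ℕ) : (lucas n : ℝ) = goldenRatio ^ n + goldenConj ^ n := by
  induction n using Nat.twoStepInduction with
  | zero => norm_num [lucas]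
  | one => simp [lucas, goldenRatio_add_goldenConj]
  | more n ih₀ ih₁ =>
    rw [lucas, Int.cast_add, ih₀, ih₁]
    linear_combination -goldenRatio ^ n * goldenRatio_sq - goldenConj ^ n * goldenConj_sq

theorem alpha_pow_ge {n : ℕ} (hn : 10 ≤ n) : 120 ≤ alpha ^ n := by
  have h : (1.618 : ℝ) ≤ alpha := by
    have : (2.236 : ℝ) ≤ √5 := Real.le_sqrt_of_sq_le (by norm_num)
    unfold alpha
    linarith
  calc (120 : ℝ) ≤ 1.618 ^ 10 := by norm_num
    _ ≤ alpha ^ 10 := by gcongr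
    _ ≤ alpha ^ n := pow_le_pow_right₀ (by linarith) hn

theorem shifted_cubic_root_eq {F L x y z w : ℝ} (hxy : x ≠ y) (hyz : y ≠ z) (hxz : x ≠ z)
    (hx : (x - F) * (x - L) * x - 1 = 0) (hy : (y - F) * (y - L) * y - 1 = 0)
    (hz : (z - F) * (z - L) * z - 1 = 0) (hw : (w - F) * (w - L) * w - 1 = 0) :
    w = x ∨ w = y ∨ w = z := by
  have h₁ : x ^ 2 + x * y + y ^ 2 - (F + L) * (x + y) + F * L = 0 :=
    mul_left_cancel₀ (sub_ne_zero.2 hxy) (by linear_combination hx - hy)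
  have h₂ : x ^ 2 + x * z + z ^ 2 - (F + L) * (x + z) + F * L = 0 :=
    mul_left_cancel₀ (sub_ne_zero.2 hxz) (by linear_combination hx - hz)
  have h₃ : x + y + z - (F + L) = 0 :=
    mul_left_cancel₀ (sub_ne_zero.2 hyz) (by linear_combination h₁ - h₂)
  have h : (w - x) * ((w - y) * (w - z)) = 0 := by
    linear_combination hw - hx - (w - x) * (h₁ + (w - y) * h₃)
  simpa [sub_eq_zero] using h

/-- Sign changes of `(X - F) (X - L) X - 1` when `F = (A - c) / √5` and `L = A + c`
with `|c| = A⁻¹`. -/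
theorem shifted_cubic_signs {A t c s F L : ℝ} (hA : 120 ≤ A) (ht : A * t = 1) (hc : |c| = t)
    (hs : s ^ 2 = 5) (hs₀ : 0 ≤ s) (hF : s * F = A - c) (hL : L = A + c) :
    s * t ^ 2 + t ^ 4 < F - 6 * t ^ 2 ∧ F < L ∧
    (s * t ^ 2 - t ^ 4 - F) * (s * t ^ 2 - t ^ 4 - L) * (s * t ^ 2 - t ^ 4) - 1 ≤ 0 ∧
    0 ≤ (s * t ^ 2 + t ^ 4 - F) * (s * t ^ 2 + t ^ 4 - L) * (s * t ^ 2 + t ^ 4) - 1 ∧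
    0 ≤ (F - 6 * t ^ 2 - F) * (F - 6 * t ^ 2 - L) * (F - 6 * t ^ 2) - 1 ∧
    0 ≤ (L + 4 * t ^ 2 - F) * (L + 4 * t ^ 2 - L) * (L + 4 * t ^ 2) - 1 := by
  have ht₀ : 0 < t := by
    by_contra! h
    nlinarith
  have ht₁ : t ≤ 1 / 120 := by nlinarith
  have hcc : c ^ 2 = t ^ 2 := by rw [← hc, sq_abs]
  have hc₁ := abs_le.1 hc.le
  have hs₁ : 2.236 ≤ s := by nlinarith
  have hs₂ : s ≤ 2.237 := by nlinarith
  have hFv : 5 * F = s * (A - c) := by rw [← hF, ← hs]; ring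
  have hF₁ : 0.44 * A ≤ F := by nlinarith
  have hF₂ : F ≤ 0.45 * A := by nlinarith
  have hq : t ^ 2 ≤ 1 / 14400 := by nlinarith
  have hq₀ : 0 < t ^ 2 := by positivity
  have hAq : t ^ 2 * A ^ 2 = 1 := by rw [← mul_pow, mul_comm, ht, one_pow]
  have hFL : 5 * (F * L) = s * (A ^ 2 - t ^ 2) := by
    rw [hL, ← hcc]; linear_combination (A + c) * hFv
  have hq4 : t ^ 4 = t ^ 2 * t ^ 2 := by ring
  have hq4₀ : 0 < t ^ 4 := by positivity
  have hq4' : t ^ 4 ≤ 1 / 14400 * t ^ 2 := by rw [hq4]; gcongr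
  have hsq : s * t ^ 2 ≤ 2.237 * t ^ 2 := by gcongr
  have hsq' : 2.236 * t ^ 2 ≤ s * t ^ 2 := by gcongr
  have hcube : t ^ 4 * A = t ^ 3 := by linear_combination t ^ 3 * ht
  have ht3 : t ^ 3 ≤ 1 / 120 * t ^ 2 := by
    rw [pow_succ']; gcongr
  refine ⟨by linarith, by linarith, ?_, ?_, ?_, ?_⟩
  · set x := s * t ^ 2 - t ^ 4 with hx
    have hx₀ : 0 ≤ x := by linarith
    have hx₁ : x ≤ 3 * t ^ 2 := by linarith
    have hx₃ : x ^ 3 ≤ 27 * (t ^ 4 * t ^ 2) := by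
      calc x ^ 3 ≤ (3 * t ^ 2) ^ 3 := by gcongr
        _ = _ := by ring
    have hx₄ : 0 ≤ x ^ 2 * (F + L) := mul_nonneg (by positivity) (by linarith)
    have hmain : 5 * (x * (F * L)) = (5 - s * t ^ 2) * (1 - t ^ 4) := by
      linear_combination x * hFL + s * (A ^ 2 - t ^ 2) * hx + s * (s - t ^ 2) * hAq
        + (1 - t ^ 4) * hs
    have h₁ : t ^ 4 * t ^ 2 ≤ t ^ 4 * (1 / 14400) := by gcongr
    have h₂ : s * t ^ 2 * t ^ 4 ≤ 1 * t ^ 4 := by gcongr; linarith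
    linarith
  · set x := s * t ^ 2 + t ^ 4 with hx
    have hx₀ : 0 ≤ x := by linarith
    have hx₁ : x ≤ 3 * t ^ 2 := by linarith
    have hx₃ : 0 ≤ x ^ 3 := by positivity
    have hx₄ : x ^ 2 * (F + L) ≤ 9 * t ^ 4 * (1.5 * A) := by
      calc x ^ 2 * (F + L) ≤ (3 * t ^ 2) ^ 2 * (1.5 * A) := by gcongr <;> linarith
        _ = _ := by ring
    have hmain : 5 * (x * (F * L)) = (5 + s * t ^ 2) * (1 - t ^ 4) := by
      linear_combination x * hFL + s * (A ^ 2 - t ^ 2) * hx + s * (s + t ^ 2) * hAq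
        + (1 - t ^ 4) * hs
    have h₂ : s * t ^ 2 * t ^ 4 ≤ 1 * t ^ 4 := by gcongr; linarith
    linarith
  · have h₁ : 0.43 * A ≤ F - 6 * t ^ 2 := by linarith
    have h₂ : 0.54 * A ≤ L - F + 6 * t ^ 2 := by linarith
    have h₃ : 0.54 * A * (0.43 * A) ≤ (L - F + 6 * t ^ 2) * (F - 6 * t ^ 2) := by gcongr; linarith
    nlinarith
  · have h₁ : 0.54 * A ≤ L + 4 * t ^ 2 - F := by linarith
    have h₂ : 0.9 * A ≤ L + 4 * t ^ 2 := by linarith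
    have h₃ : 0.54 * A * (0.9 * A) ≤ (L + 4 * t ^ 2 - F) * (L + 4 * t ^ 2) := by gcongr; linarith
    nlinarith

theorem fpoly_roots_exist (n : ℕ) (hn : 10 ≤ n) :
    ∃ r1 r2 r3 : ℝ, r3 < r1 ∧ r1 < r2 ∧
      fpoly n r1 = 0 ∧ fpoly n r2 = 0 ∧ fpoly n r3 = 0 ∧
      (∀ x : ℝ, fpoly n x = 0 → x = r1 ∨ x = r2 ∨ x = r3) ∧
      |r1 - (Nat.fib n : ℝ)| ≤ 6 * alpha ^ (-(2 * n : ℤ)) ∧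
      |r2 - (lucas n : ℝ)| ≤ 4 * alpha ^ (-(2 * n : ℤ)) ∧
      |r3 - Real.sqrt 5 * alpha ^ (-(2 * n : ℤ))| ≤ alpha ^ (-(4 * n : ℤ)) := by
  have hA := alpha_pow_ge hn
  set t : ℝ := (alpha ^ n)⁻¹ with htdef
  have ht : alpha ^ n * t = 1 := mul_inv_cancel₀ (by positivity)
  have ht₂ : alpha ^ (-(2 * n : ℤ)) = t ^ 2 := by
    rw [zpow_neg, mul_comm, zpow_mul, htdef, inv_pow]; norm_cast
  have ht₄ : alpha ^ (-(4 * n : ℤ)) = t ^ 4 := by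
    rw [zpow_neg, mul_comm, zpow_mul, htdef, inv_pow]; norm_cast
  have hc : |goldenConj ^ n| = t := by
    rw [abs_pow, abs_of_neg goldenConj_neg, ← inv_goldenRatio, inv_pow, htdef,
      alpha_eq_goldenRatio]
  have hF : √5 * (Nat.fib n : ℝ) = alpha ^ n - goldenConj ^ n := by
    rw [coe_fib_eq, alpha_eq_goldenRatio]; field_simp
  obtain ⟨h31, h12, g3, g3', g1, g2⟩ := shifted_cubic_signs hA ht hc
    (Real.sq_sqrt (by norm_num)) (Real.sqrt_nonneg 5) hF (coe_lucas_eq n)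
  rw [ht₂, ht₄]
  have hcont : Continuous (fpoly n) := by unfold fpoly; fun_prop
  have hq₂ : 0 ≤ t ^ 2 := by positivity
  have hq₄ : 0 ≤ t ^ 4 := by positivity
  obtain ⟨r3, ⟨a3, b3⟩, e3⟩ := intermediate_value_Icc
    (by linarith : √5 * t ^ 2 - t ^ 4 ≤ √5 * t ^ 2 + t ^ 4) hcont.continuousOn ⟨g3, g3'⟩
  obtain ⟨r1, ⟨a1, b1⟩, e1⟩ := intermediate_value_Icc'
    (by linarith : (Nat.fib n : ℝ) - 6 * t ^ 2 ≤ Nat.fib n) hcont.continuousOn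
    ⟨by simp [fpoly], g1⟩
  obtain ⟨r2, ⟨a2, b2⟩, e2⟩ := intermediate_value_Icc
    (by linarith : (lucas n : ℝ) ≤ lucas n + 4 * t ^ 2) hcont.continuousOn
    ⟨by simp [fpoly], g2⟩
  have l31 : r3 < r1 := by linarith
  have l12 : r1 < r2 := by linarith
  refine ⟨r1, r2, r3, l31, l12, e1, e2, e3, fun x hx ↦
    shifted_cubic_root_eq l12.ne (l31.trans l12).ne' l31.ne' e1 e2 e3 hx, ?_, ?_, ?_⟩ <;>
  rw [abs_le] <;> constructor <;> linarith
end

section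
/- For every integer n ≥ 10, the three real roots r_3 < r_1 < r_2 of f_n satisfy the refined approximations |r_1 − ( (1/√5)·α^n − (−1)^n·(1/√5)·α^{−n} + (5/(1−√5))·α^{−2n} )| ≤ 12·α^{−3n} and |r_2 − ( α^n + (−1)^n·α^{−n} )| ≤ 4·α^{−2n}. -/
open Real

theorem lucas_binet : ∀ n : ℕ, (lucas n : ℝ) = goldenRatio ^ n + goldenConj ^ n
  | 0 => by norm_num [lucas]
  | 1 => by simp [lucas, goldenRatio_add_goldenConj]
  | n + 2 => by
    rw [lucas, Int.cast_add, lucas_binet (n + 1), lucas_binet n]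
    linear_combination (-goldenRatio ^ n) * goldenRatio_sq - goldenConj ^ n * goldenConj_sq

theorem goldenConj_pow (n : ℕ) : goldenConj ^ n = (-1) ^ n * (goldenRatio ^ n)⁻¹ := by
  rw [eq_mul_inv_iff_mul_eq₀ (pow_ne_zero _ goldenRatio_ne_zero), ← mul_pow,
    goldenConj_mul_goldenRatio]

/-- Vieta's formulas for three distinct roots of `(X - F) * (X - L) * X - 1`. -/
theorem cubic_vieta {F L x y z : ℝ} (hxy : x ≠ y) (hxz : x ≠ z) (hyz : y ≠ z)
    (hx : (x - F) * (x - L) * x = 1) (hy : (y - F) * (y - L) * y = 1)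
    (hz : (z - F) * (z - L) * z = 1) :
    x + y + z = F + L ∧ x * y + x * z + y * z = F * L ∧ x * y * z = 1 := by
  have exy : x ^ 2 + x * y + y ^ 2 - (F + L) * (x + y) + F * L = 0 := by
    apply mul_left_cancel₀ (sub_ne_zero.2 hxy)
    linear_combination hx - hy
  have exz : x ^ 2 + x * z + z ^ 2 - (F + L) * (x + z) + F * L = 0 := by
    apply mul_left_cancel₀ (sub_ne_zero.2 hxz)
    linear_combination hx - hz
  have e1 : x + y + z = F + L := by
    apply mul_left_cancel₀ (sub_ne_zero.2 hyz)
    linear_combination exy - exz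
  have e2 : x * y + x * z + y * z = F * L := by
    linear_combination (x + y) * e1 - exy
  refine ⟨e1, e2, ?_⟩
  linear_combination hx - x ^ 2 * e1 + x * e2

/-- Location of three real roots of `(X - F) * (X - L) * X - 1` for `0 < F < L`. -/
theorem cubic_roots_location {F L x y z : ℝ} (hF : 0 < F) (hFL : F < L) (hzx : z < x) (hxy : x < y)
    (hx : (x - F) * (x - L) * x = 1) (hy : (y - F) * (y - L) * y = 1)
    (hz : (z - F) * (z - L) * z = 1) :
    0 < z ∧ x < F ∧ L < y := by
  have pos {t : ℝ} (ht : (t - F) * (t - L) * t = 1) : 0 < t := by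
    by_contra! h
    have : 0 ≤ (t - F) * (t - L) := mul_nonneg_of_nonpos_of_nonpos (by linarith) (by linarith)
    nlinarith [mul_nonneg this (neg_nonneg.2 h)]
  have outside {t : ℝ} (ht : (t - F) * (t - L) * t = 1) : t < F ∨ L < t := by
    by_contra! h
    have : 0 ≤ (t - F) * (L - t) := mul_nonneg (by linarith) (by linarith)
    nlinarith [mul_nonneg this (pos ht).le]
  obtain ⟨e1, e2, e3⟩ := cubic_vieta hxy.ne hzx.ne' (hzx.trans hxy).ne' hx hy hz
  have hprod : (F - x) * (F - y) * (F - z) = -1 := by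
    linear_combination (-F ^ 2) * e1 + F * e2 - e3
  have hzF : z < F := (outside hz).resolve_right fun h => by linarith
  have hLy : L < y := (outside hy).resolve_left fun h => by
    have := mul_pos (mul_pos (sub_pos.2 (hxy.trans h)) (sub_pos.2 h)) (sub_pos.2 hzF)
    linarith
  refine ⟨pos hz, (outside hx).resolve_right fun h => ?_, hLy⟩
  have := mul_pos (mul_pos (sub_pos.2 (hFL.trans h)) (sub_pos.2 (hFL.trans hLy))) (sub_pos.2 hzF)
  linarith

/-- Approximations of the two large roots of `(X - F) * (X - L) * X - 1`, where `F` and `L` are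
given by Binet's formulas in terms of `a` and `b = ±a⁻¹`. -/
theorem cubic_roots_approx {s a b F L x y z : ℝ} (hs : 0 < s) (hs5 : s ^ 2 = 5) (ha : 100 ≤ a)
    (hab : |a * b| = 1) (hF : F = (a - b) / s) (hL : L = a + b) (hzx : z < x) (hxy : x < y)
    (hx : (x - F) * (x - L) * x = 1) (hy : (y - F) * (y - L) * y = 1)
    (hz : (z - F) * (z - L) * z = 1) :
    |x - (F + 5 / (1 - s) * (a ^ 2)⁻¹)| ≤ 12 * (a ^ 3)⁻¹ ∧ |y - L| ≤ 4 * (a ^ 2)⁻¹ := by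
  have hs1 : 2.236 < s := by nlinarith
  have hs2 : s < 2.237 := by nlinarith
  have ha0 : 0 < a := by linarith
  have hb : |b| ≤ 1 / 100 := by
    rw [abs_mul, abs_of_pos ha0] at hab
    nlinarith [abs_nonneg b]
  obtain ⟨hb1, hb2⟩ := abs_le.1 hb
  obtain ⟨hab1, hab2⟩ := abs_le.1 hab.le
  have hF5 : F = s * (a - b) / 5 := by
    rw [hF]; field_simp; rw [hs5]
  have hF1 : 0.44 * a ≤ F := by rw [hF5]; nlinarith only [hs1, hs2, hb1, hb2, ha]
  have hF2 : F ≤ 0.45 * a := by rw [hF5]; nlinarith only [hs1, hs2, hb1, hb2, ha]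
  have hL1 : 0.99 * a ≤ L := by linarith
  have hL2 : L ≤ 1.01 * a := by linarith
  obtain ⟨hz0, hxF, hLy⟩ := cubic_roots_location (by linarith) (by linarith) hzx hxy hx hy hz
  obtain ⟨e1, -, -⟩ := cubic_vieta hxy.ne hzx.ne' (hzx.trans hxy).ne' hx hy hz
  have hyL : (y - L) * a ^ 2 ≤ 2 := by
    have h1 : (0.54 * a) * (0.99 * a) ≤ (y - F) * y :=
      mul_le_mul (by linarith) (by linarith) (by positivity) (by linarith)
    have h2 := mul_le_mul_of_nonneg_left h1 (sub_pos.2 hLy).le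
    have h3 : 0 ≤ (y - L) * a ^ 2 := mul_nonneg (sub_pos.2 hLy).le (sq_nonneg a)
    linarith
  have ha2 : 10000 ≤ a ^ 2 := by nlinarith only [ha]
  have hyL' : y - L ≤ 2 / 10000 := by
    have := mul_le_mul_of_nonneg_left ha2 (sub_pos.2 hLy).le
    linarith
  have hxF1 : 0.21 * a ≤ x := by linarith
  have hD : (F - x) * a ≤ 1 / 10 := by
    have h1 : (0.21 * a) * (0.54 * a) ≤ x * (L - x) :=
      mul_le_mul hxF1 (by linarith) (by positivity) (by linarith)
    have h2 : 10 * a ≤ x * (L - x) := by nlinarith only [h1, ha]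
    have h3 := mul_le_mul_of_nonneg_left h2 (sub_pos.2 hxF).le
    linarith
  have hD0 : 0 < F - x := sub_pos.2 hxF
  have hFL : F * (L - F) = (a ^ 2 * (s - 1) + 2 * (a * b) - b ^ 2 * (s + 1)) / 5 := by
    rw [hF5, hL]
    linear_combination (-(a - b) ^ 2 / 25) * hs5
  have hbsq : b ^ 2 ≤ 1 / 10000 := by nlinarith only [hb1, hb2]
  have hK : |x * (L - x) - a ^ 2 * (s - 1) / 5| ≤ 1 := by
    have e : x * (L - x) = F * (L - F) + (F - x) * (2 * F - L) - (F - x) ^ 2 := by ring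
    rw [e, hFL]
    have h1 : |(F - x) * (2 * F - L)| ≤ 1 / 10 := by
      rw [abs_mul, abs_of_pos hD0]
      refine le_trans (mul_le_mul_of_nonneg_left ?_ hD0.le) hD
      rw [abs_le]; constructor <;> linarith
    obtain ⟨h1, h1'⟩ := abs_le.1 h1
    have h2 : (F - x) ^ 2 ≤ 1 / 100 := by nlinarith only [hD, hD0, ha]
    have h3 : b ^ 2 * (s + 1) ≤ 1 / 100 := by nlinarith only [hbsq, hs2, sq_nonneg b]
    have h4 : 0 ≤ b ^ 2 * (s + 1) := by positivity
    rw [abs_le]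
    constructor <;> linarith [sq_nonneg (F - x)]
  obtain ⟨hK1, hK2⟩ := abs_le.1 hK
  constructor
  · set K := x * (L - x) with hKdef
    set T := a ^ 2 * (s - 1) / 5 with hT
    have hT1 : 0.24 * a ^ 2 ≤ T := by rw [hT]; nlinarith only [hs1, ha2]
    have hK0 : 0.23 * a ^ 2 ≤ K := by linarith
    have hKp : 0 < K := by linarith
    have hTp : 0 < T := by linarith
    have e : x - (F + 5 / (1 - s) * (a ^ 2)⁻¹) = (K - T) / (K * T) := by
      have hxK : x - F = -1 / K := by
        rw [eq_div_iff hKp.ne', hKdef]; linear_combination -hx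
      have hTT : 5 / (1 - s) * (a ^ 2)⁻¹ = -1 / T := by
        have : 1 - s ≠ 0 := by linarith
        have : s - 1 ≠ 0 := by linarith
        rw [hT]; field_simp; ring
      rw [← sub_sub, hxK, hTT]
      field_simp
      ring
    rw [e, abs_div, abs_of_pos (mul_pos hKp hTp), ← div_eq_mul_inv,
      div_le_div_iff₀ (mul_pos hKp hTp) (by positivity)]
    have hKT : 0.05 * (a ^ 3 * a) ≤ K * T := by
      have := mul_le_mul hK0 hT1 (by positivity) hKp.le
      linarith [pow_pos ha0 4]
    have h3 : 0 < a ^ 3 := by positivity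
    linarith [mul_le_mul_of_nonneg_right hK h3.le, mul_le_mul_of_nonneg_left ha h3.le]
  · rw [abs_of_pos (sub_pos.2 hLy), ← div_eq_mul_inv, le_div_iff₀ (by positivity)]
    linarith

theorem fpoly_roots_refined (n : ℕ) (hn : 10 ≤ n) (r1 r2 r3 : ℝ)
    (h1 : fpoly n r1 = 0) (h2 : fpoly n r2 = 0) (h3 : fpoly n r3 = 0)
    (h31 : r3 < r1) (h12 : r1 < r2) :
    |r1 - ((1 / Real.sqrt 5) * alpha ^ (n : ℤ)
        - (-1 : ℝ) ^ n * (1 / Real.sqrt 5) * alpha ^ (-(n : ℤ))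
        + (5 / (1 - Real.sqrt 5)) * alpha ^ (-(2 * n : ℤ)))| ≤ 12 * alpha ^ (-(3 * n : ℤ)) ∧
    |r2 - (alpha ^ (n : ℤ) + (-1 : ℝ) ^ n * alpha ^ (-(n : ℤ)))| ≤ 4 * alpha ^ (-(2 * n : ℤ)) := by
  have hpow {m k : ℕ} : alpha ^ (-(k * m : ℤ)) = ((goldenRatio ^ m) ^ k)⁻¹ := by
    rw [alpha_eq_goldenRatio, zpow_neg, ← pow_mul, mul_comm m k, ← Nat.cast_mul, zpow_natCast]
  have h100 : 100 ≤ goldenRatio ^ n := by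
    have h5 : 2.2 ≤ √5 := Real.le_sqrt_of_sq_le (by norm_num)
    have hg : 1.6 ≤ goldenRatio := by rw [goldenRatio]; linarith
    calc (100 : ℝ) ≤ 1.6 ^ 10 := by norm_num
      _ ≤ goldenRatio ^ 10 := by gcongr
      _ ≤ goldenRatio ^ n := pow_le_pow_right₀ one_lt_goldenRatio.le hn
  have hab : |goldenRatio ^ n * goldenConj ^ n| = 1 := by
    rw [← mul_pow, goldenRatio_mul_goldenConj, abs_neg_one_pow]
  obtain ⟨hr1, hr2⟩ := cubic_roots_approx (Real.sqrt_pos.2 (by norm_num))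
    (Real.sq_sqrt (by norm_num)) h100 hab (Real.coe_fib_eq n) (lucas_binet n) h31 h12
    (sub_eq_zero.1 h1) (sub_eq_zero.1 h2) (sub_eq_zero.1 h3)
  have hp1 := hpow (m := n) (k := 1)
  have hp2 := hpow (m := n) (k := 2)
  have hp3 := hpow (m := n) (k := 3)
  push_cast at hp1 hp2 hp3
  rw [one_mul, pow_one] at hp1
  rw [hp1, hp2, hp3, zpow_natCast, alpha_eq_goldenRatio]
  rw [Real.coe_fib_eq, goldenConj_pow] at hr1
  rw [lucas_binet, goldenConj_pow] at hr2
  refine ⟨?_, hr2⟩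
  convert hr1 using 4
  ring
end

section
/- For every integer n ≥ 10, the three real roots r_3 < r_1 < r_2 of f_n satisfy: |log|r_1| − (n·log α − log √5)| ≤ 3·α^{−2n}; |log|r_1 − F_n| − (−2n·log α + log(5/(√5−1)))| ≤ 6·α^{−n}; |log|r_2| − n·log α| ≤ 4·α^{−2n}; |log|r_2 − F_n| − (n·log α + log(1 − 1/√5))| ≤ 6·α^{−2n}; |log|r_3| − (−2n·log α + log √5)| ≤ α^{−2n}; and |log|r_3 − F_n| − (n·log α − log √5)| ≤ 3·α^{−2n}. -/
open Real

/-- The three roots of `(X - F) (X - L) X = 1` are separated by `0`, `F / 2`, `F` and `L`. -/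
theorem cubic_roots_separated {F L r1 r2 r3 : ℝ} (hF : 10 ≤ F) (hL : 2 * F < L)
    (h1 : (r1 - F) * (r1 - L) * r1 = 1) (h2 : (r2 - F) * (r2 - L) * r2 = 1)
    (h3 : (r3 - F) * (r3 - L) * r3 = 1) (h31 : r3 < r1) (h12 : r1 < r2) :
    0 < r3 ∧ r3 < F / 2 ∧ F / 2 < r1 ∧ r1 < F ∧ L < r2 := by
  have pos : ∀ x : ℝ, (x - F) * (x - L) * x = 1 → 0 < x := by
    intro x hx
    by_contra! hneg
    have h : 0 ≤ (F - x) * (L - x) := mul_nonneg (by linarith) (by linarith)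
    nlinarith [mul_nonneg h (neg_nonneg.2 hneg)]
  have outside : ∀ x : ℝ, (x - F) * (x - L) * x = 1 → x < F ∨ L < x := by
    intro x hx
    by_contra! hin
    have h : 0 ≤ (x - F) * (L - x) := mul_nonneg (by linarith) (by linarith)
    nlinarith [mul_nonneg h (pos x hx).le]
  have quot : ∀ x y : ℝ, x < y → (x - F) * (x - L) * x = 1 → (y - F) * (y - L) * y = 1 →
      x ^ 2 + x * y + y ^ 2 - (F + L) * (x + y) + F * L = 0 := by
    intro x y hxy hx hy
    have h : (y - x) * (x ^ 2 + x * y + y ^ 2 - (F + L) * (x + y) + F * L) = 0 := by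
      linear_combination hy - hx
    exact (mul_eq_zero.1 h).resolve_left (sub_pos.2 hxy).ne'
  have sum : r1 + r2 + r3 = F + L := by
    have h : (r2 - r3) * (r1 + r2 + r3 - (F + L)) = 0 := by
      linear_combination quot r1 r2 h12 h1 h2 - quot r3 r1 h31 h3 h1
    linarith [(mul_eq_zero.1 h).resolve_left (by linarith)]
  have prod : r1 * r2 * r3 = 1 := by
    linear_combination h1 - r1 * quot r1 r2 h12 h1 h2 + r1 * r2 * sum
  have p1 := pos r1 h1
  have p3 := pos r3 h3
  have l2 : L < r2 := by
    rcases outside r2 h2 with h | h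
    · linarith
    · exact h
  have l1 : r1 < F := by
    rcases outside r1 h1 with h | h
    · exact h
    · linarith
  refine ⟨p3, by linarith, ?_, l1, l2⟩
  by_contra! hr
  have hFL : 5 * (3 / 4 * L) ≤ (F - r1) * (L - r1) :=
    mul_le_mul (by linarith) (by linarith) (by linarith) (by linarith)
  have hr1 : r1 * (5 * (3 / 4 * L)) ≤ 1 := by
    nlinarith [mul_le_mul_of_nonneg_left hFL p1.le]
  have hr1' : r1 ≤ 1 / 25 := by
    nlinarith [mul_le_mul_of_nonneg_left (show (20 : ℝ) ≤ L by linarith) p1.le]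
  have hr2 : r1 * r2 ≤ 1 := by
    nlinarith [mul_le_mul_of_nonneg_left (show r2 ≤ 3 / 2 * L by linarith) p1.le]
  nlinarith [mul_le_mul_of_nonneg_right hr2 p3.le]

theorem abs_log_le_of_abs_sub_one_le {x c : ℝ} (hc : c ≤ 1 / 100) (h : |x - 1| ≤ c) :
    |Real.log x| ≤ 21 / 20 * c := by
  obtain ⟨hl, hu⟩ := abs_le.1 h
  have hx : 0 < x := by linarith
  have hc0 : 0 ≤ c := (abs_nonneg _).trans h
  refine abs_le.2 ⟨?_, by linarith [Real.log_le_sub_one_of_pos hx]⟩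
  have h1 := Real.one_sub_inv_le_log_of_pos hx
  have h2 : x⁻¹ ≤ 1 + 21 / 20 * c := by
    rw [inv_le_iff_one_le_mul₀ hx]
    nlinarith
  linarith

set_option maxHeartbeats 1000000 in
/-- Logarithmic estimates for the roots of `(X - F) (X - L) X = 1` when `F = A (1 - b) / √5` and
`L = A (1 + b)` with `A` large and `b` of size at most `A⁻²`. -/
theorem cubic_roots_log_approx {A b r1 r2 r3 : ℝ} (hA : 120 ≤ A) (hb : |b| ≤ (A ^ 2)⁻¹)
    (h1 : (r1 - A * (1 - b) / √5) * (r1 - A * (1 + b)) * r1 = 1)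
    (h2 : (r2 - A * (1 - b) / √5) * (r2 - A * (1 + b)) * r2 = 1)
    (h3 : (r3 - A * (1 - b) / √5) * (r3 - A * (1 + b)) * r3 = 1)
    (h31 : r3 < r1) (h12 : r1 < r2) :
    |Real.log |r1| - (Real.log A - Real.log √5)| ≤ 3 * (A ^ 2)⁻¹ ∧
    |Real.log |r1 - A * (1 - b) / √5| - (-2 * Real.log A + Real.log (5 / (√5 - 1)))|
      ≤ 6 * A⁻¹ ∧
    |Real.log |r2| - Real.log A| ≤ 4 * (A ^ 2)⁻¹ ∧
    |Real.log |r2 - A * (1 - b) / √5| - (Real.log A + Real.log (1 - 1 / √5))|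
      ≤ 6 * (A ^ 2)⁻¹ ∧
    |Real.log |r3| - (-2 * Real.log A + Real.log √5)| ≤ (A ^ 2)⁻¹ ∧
    |Real.log |r3 - A * (1 - b) / √5| - (Real.log A - Real.log √5)| ≤ 3 * (A ^ 2)⁻¹ := by
  have hA0 : 0 < A := by linarith
  have hq2 : √5 ^ 2 = 5 := Real.sq_sqrt (by norm_num)
  have hq0 : 0 < √5 := Real.sqrt_pos.2 (by norm_num)
  have hq1 : 2.236 < √5 := Real.lt_sqrt_of_sq_lt (by norm_num)
  have hq3 : √5 < 2.2361 := (Real.sqrt_lt' (by norm_num)).2 (by norm_num)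
  set q := √5 with hq
  set v := (A ^ 2)⁻¹ with hv
  have hv0 : 0 < v := by positivity
  have hvA : v * A ^ 2 = 1 := inv_mul_cancel₀ (by positivity)
  have hv1 : v ≤ 1 / 14400 := by
    rw [hv, inv_le_comm₀ (by positivity) (by norm_num)]
    nlinarith
  obtain ⟨hbl, hbu⟩ := abs_le.1 hb
  set F := A * (1 - b) / q with hFdef
  set L := A * (1 + b) with hLdef
  have hqF : q * F = A * (1 - b) := by rw [hFdef]; field_simp
  have hbA1 : A * b ≤ A * (1 / 14400) := by gcongr; linarith
  have hbA2 : A * (-1 / 14400) ≤ A * b := by gcongr; linarith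
  have hqA1 : 2.236 * A ≤ q * A := by gcongr
  have hqA2 : q * A ≤ 2.2361 * A := by gcongr
  have hF1 : 0.447 * A ≤ F := le_of_mul_le_mul_left (by linarith) hq0
  have hF2 : F ≤ 0.4474 * A := le_of_mul_le_mul_left (by linarith) hq0
  have hL1 : 0.999 * A ≤ L := by linarith
  obtain ⟨p3, u3, l1, u1, l2⟩ :=
    cubic_roots_separated (by linarith) (by linarith) h1 h2 h3 h31 h12
  -- scaled smallness of a displacement `w`
  have small : ∀ w : ℝ, 0 ≤ w → w * A ^ 2 ≤ 10 →
      0 ≤ w / A ∧ w / A ≤ v / 12 ∧ 0 ≤ q * (w / A) ∧ q * (w / A) ≤ v / 5 := by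
    intro w hw hwA
    have s1 : 0 ≤ w / A := by positivity
    suffices s2 : w / A ≤ v / 12 from
      ⟨s1, s2, by positivity, by linarith [mul_le_mul hq3.le s2 s1 (by norm_num)]⟩
    rw [div_le_iff₀ hA0]
    have h10 : w ≤ 10 * v := by
      rw [hv, ← div_eq_mul_inv, le_div_iff₀ (by positivity)]
      exact hwA
    linarith [mul_le_mul_of_nonneg_left hA hv0.le]
  have logA : ∀ x c k : ℝ, 0 < x → 0 < k → c ≤ 1 / 100 → |x / A / k - 1| ≤ c →
      |Real.log x - (Real.log A + Real.log k)| ≤ 21 / 20 * c := by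
    intro x c k hx hk hc h
    have := abs_log_le_of_abs_sub_one_le hc h
    rwa [Real.log_div (by positivity) hk.ne', Real.log_div hx.ne' hA0.ne', sub_sub] at this
  have hk : 0 < 1 - 1 / q := by
    rw [sub_pos, div_lt_one hq0]; linarith
  have nearF : ∀ w : ℝ, 0 ≤ w → w * A ^ 2 ≤ 10 → w < F →
      |Real.log (F - w) - (Real.log A - Real.log q)| ≤ 3 * v := by
    intro w hw hwA hwF
    obtain ⟨s1, s2, s3, s4⟩ := small w hw hwA
    have e : (F - w) / A / q⁻¹ - 1 = -b - q * (w / A) := by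
      rw [hFdef]; field_simp; ring
    have := logA (F - w) (2 * v) q⁻¹ (by linarith) (by positivity) (by linarith)
      (by rw [e, abs_le]; constructor <;> linarith)
    rw [Real.log_inv, ← sub_eq_add_neg] at this
    linarith
  have nearLF : ∀ w : ℝ, 0 ≤ w → w * A ^ 2 ≤ 10 →
      |Real.log (L - F + w) - (Real.log A + Real.log (1 - 1 / q))| ≤ 4 * v := by
    intro w hw hwA
    obtain ⟨s1, s2, s3, s4⟩ := small w hw hwA
    have hq1' : q - 1 ≠ 0 := by linarith
    have hv2 : v * 2.236 ≤ v * q := by gcongr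
    have hv3 : v * q ≤ v * 2.2361 := by gcongr
    have hb1 : b * (q + 1) ≤ v * (q + 1) := by gcongr
    have hb2 : -v * (q + 1) ≤ b * (q + 1) := by gcongr
    have e : (L - F + w) / A / (1 - 1 / q) - 1
        = (q * (w / A) + b * (q + 1)) / (q - 1) := by
      rw [hFdef, hLdef]; field_simp; ring
    have := logA (L - F + w) (3 * v) (1 - 1 / q) (by linarith) hk (by linarith)
      (by
        rw [e, abs_le, le_div_iff₀ (by linarith), div_le_iff₀ (by linarith)]
        constructor <;> linarith)
    linarith
  -- displacement bounds
  have hd : (F - r1) * A ^ 2 ≤ 10 := by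
    have h : 0.552 * A * (0.2235 * A) ≤ (L - r1) * r1 :=
      mul_le_mul (by linarith) (by linarith) (by linarith) (by linarith)
    linarith [mul_le_mul_of_nonneg_left h (sub_pos.2 u1).le]
  have he : (r2 - L) * A ^ 2 ≤ 10 := by
    have h : 0.55 * A * (0.999 * A) ≤ (r2 - F) * r2 :=
      mul_le_mul (by linarith) (by linarith) (by linarith) (by linarith)
    linarith [mul_le_mul_of_nonneg_left h (sub_pos.2 l2).le]
  have ht : r3 * A ^ 2 ≤ 10 := by
    have h : 0.2235 * A * (0.55 * A) ≤ (F - r3) * (L - r3) :=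
      mul_le_mul (by linarith) (by linarith) (by linarith) (by linarith)
    linarith [mul_le_mul_of_nonneg_left h p3.le]
  have b1 := nearF (F - r1) (by linarith) hd (by linarith)
  rw [sub_sub_cancel] at b1
  refine ⟨?_, ?_, ?_, ?_, ?_, ?_⟩
  · rwa [abs_of_pos (show 0 < r1 by linarith)]
  · have b2 := nearLF (F - r1) (by linarith) hd
    rw [show L - F + (F - r1) = L - r1 by ring] at b2
    have hlog : Real.log (F - r1) + Real.log (L - r1) + Real.log r1 = 0 := by
      rw [← Real.log_mul (by linarith) (by linarith), ← Real.log_mul _ (by linarith),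
        show (F - r1) * (L - r1) * r1 = 1 by linarith, Real.log_one]
      exact mul_ne_zero (by linarith) (by linarith)
    have hconst : Real.log (5 / (q - 1)) = Real.log q - Real.log (1 - 1 / q) := by
      rw [← Real.log_div hq0.ne' hk.ne']
      congr 1
      have : q - 1 ≠ 0 := by linarith
      field_simp
      linarith
    have hvu : 7 * v ≤ 6 * A⁻¹ := by
      have h : v * A = A⁻¹ := by rw [hv]; field_simp
      linarith [mul_le_mul_of_nonneg_left hA hv0.le]
    rw [abs_sub_comm r1 F, abs_of_pos (sub_pos.2 u1), hconst]
    rw [abs_le] at b1 b2 ⊢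
    constructor <;> linarith
  · obtain ⟨s1, s2, s3, s4⟩ := small (r2 - L) (by linarith) he
    have e : r2 / A / 1 - 1 = b + (r2 - L) / A := by
      rw [hLdef]; field_simp; ring
    have := logA r2 (2 * v) 1 (by linarith) one_pos (by linarith)
      (by rw [e, abs_le]; constructor <;> linarith)
    rw [abs_of_pos (show 0 < r2 by linarith)]
    rw [Real.log_one, add_zero] at this
    linarith
  · have b4 := nearLF (r2 - L) (by linarith) he
    rw [show L - F + (r2 - L) = r2 - F by ring] at b4
    rw [abs_of_pos (show 0 < r2 - F by linarith)]
    linarith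
  · obtain ⟨s1, s2, s3, s4⟩ := small r3 p3.le ht
    -- the first-order terms in `b` cancel in the product of the two large factors
    have e : r3 * A ^ 2 / q * ((1 - b - q * (r3 / A)) * (1 + b - r3 / A)) = 1 := by
      refine Eq.trans ?_ h3
      rw [hFdef, hLdef]; field_simp; ring
    set x := r3 / A with hx
    set P := (1 - b - q * x) * (1 + b - x) with hP
    have hvv : v * v ≤ v * (1 / 14400) := by gcongr
    have hbb : b ^ 2 ≤ v * v := by
      rw [← sq]; exact sq_le_sq' hbl hbu
    have hbx : |b * x| ≤ v * v := by
      rw [abs_mul, abs_of_nonneg s1]; gcongr; linarith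
    have hbqx : |b * (q * x)| ≤ v * v := by
      rw [abs_mul, abs_of_nonneg s3]; gcongr; linarith
    have hxqx : q * x * x ≤ v * v := by gcongr <;> linarith
    have hxqx0 : 0 ≤ q * x * x := by positivity
    obtain ⟨hbx1, hbx2⟩ := abs_le.1 hbx
    obtain ⟨hbqx1, hbqx2⟩ := abs_le.1 hbqx
    have hP1 : |P - 1| ≤ v / 2 := by
      rw [show P - 1 = -b ^ 2 - (1 - b) * x - q * x * (1 + b) + q * x * x by rw [hP]; ring, abs_le]
      constructor <;> linarith [sq_nonneg b]
    have hlogP := abs_log_le_of_abs_sub_one_le (by linarith) hP1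
    have hP0 : P ≠ 0 := right_ne_zero_of_mul_eq_one e
    have hlog := congrArg Real.log e
    rw [Real.log_one, Real.log_mul (by positivity) hP0, Real.log_div (by positivity) hq0.ne',
      Real.log_mul p3.ne' (by positivity), Real.log_pow] at hlog
    push_cast at hlog
    rw [abs_of_pos p3]
    rw [abs_le] at hlogP ⊢
    constructor <;> linarith
  · rw [abs_sub_comm r3 F, abs_of_pos (show 0 < F - r3 by linarith)]
    exact nearF r3 p3.le ht (by linarith)

theorem lucas_eq_goldenRatio_pow_add (n : ℕ) :
    (lucas n : ℝ) = Real.goldenRatio ^ n + Real.goldenConj ^ n := by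
  induction n using Nat.twoStepInduction with
  | zero => norm_num [lucas]
  | one => simp [lucas]
  | more n ih1 ih2 =>
    simp only [lucas, Int.cast_add, ih1, ih2]
    rw [pow_add _ n 2, pow_add _ n 2, Real.goldenRatio_sq, Real.goldenConj_sq]
    ring

theorem fpoly_roots_log_approx (n : ℕ) (hn : 10 ≤ n) (r1 r2 r3 : ℝ)
    (h1 : fpoly n r1 = 0) (h2 : fpoly n r2 = 0) (h3 : fpoly n r3 = 0)
    (h31 : r3 < r1) (h12 : r1 < r2) :
    |Real.log |r1| - ((n : ℝ) * Real.log alpha - Real.log (Real.sqrt 5))|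
      ≤ 3 * alpha ^ (-(2 * n : ℤ)) ∧
    |Real.log |r1 - (Nat.fib n : ℝ)| -
        (-(2 * (n : ℝ)) * Real.log alpha + Real.log (5 / (Real.sqrt 5 - 1)))|
      ≤ 6 * alpha ^ (-(n : ℤ)) ∧
    |Real.log |r2| - (n : ℝ) * Real.log alpha| ≤ 4 * alpha ^ (-(2 * n : ℤ)) ∧
    |Real.log |r2 - (Nat.fib n : ℝ)| -
        ((n : ℝ) * Real.log alpha + Real.log (1 - 1 / Real.sqrt 5))|
      ≤ 6 * alpha ^ (-(2 * n : ℤ)) ∧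
    |Real.log |r3| - (-(2 * (n : ℝ)) * Real.log alpha + Real.log (Real.sqrt 5))|
      ≤ alpha ^ (-(2 * n : ℤ)) ∧
    |Real.log |r3 - (Nat.fib n : ℝ)| -
        ((n : ℝ) * Real.log alpha - Real.log (Real.sqrt 5))|
      ≤ 3 * alpha ^ (-(2 * n : ℤ)) := by
  have halpha : alpha = Real.goldenRatio := rfl
  have hq : (2.236 : ℝ) < √5 := Real.lt_sqrt_of_sq_lt (by norm_num)
  have hφ : (1.618 : ℝ) ≤ Real.goldenRatio := by
    rw [Real.goldenRatio]; linarith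
  set A := Real.goldenRatio ^ n with hAdef
  set B := Real.goldenConj ^ n with hBdef
  have hA : 120 ≤ A :=
    calc (120 : ℝ) ≤ 1.618 ^ 10 := by norm_num
      _ ≤ Real.goldenRatio ^ 10 := by gcongr
      _ ≤ A := pow_le_pow_right₀ (by linarith) hn
  have hA0 : 0 < A := by linarith
  have hAB : |A * B| = 1 := by
    rw [hAdef, hBdef, ← mul_pow, Real.goldenRatio_mul_goldenConj, abs_pow, abs_neg, abs_one,
      one_pow]
  have hb : |B / A| ≤ (A ^ 2)⁻¹ := by
    rw [show B / A = A * B * (A ^ 2)⁻¹ by field_simp, abs_mul, hAB, one_mul,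
      abs_of_pos (by positivity)]
  have hF : (Nat.fib n : ℝ) = A * (1 - B / A) / √5 := by
    rw [Real.coe_fib_eq]
    field_simp
    rfl
  have hL : (lucas n : ℝ) = A * (1 + B / A) := by
    rw [lucas_eq_goldenRatio_pow_add]
    field_simp
    rfl
  have hlog : (n : ℝ) * Real.log alpha = Real.log A := by
    rw [halpha, hAdef, Real.log_pow]
  have hlog2 : -(2 * (n : ℝ)) * Real.log alpha = -2 * Real.log A := by
    rw [← hlog]; ring
  have hz1 : alpha ^ (-(n : ℤ)) = A⁻¹ := by
    rw [halpha, zpow_neg, zpow_natCast]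
  have hz2 : alpha ^ (-(2 * n : ℤ)) = (A ^ 2)⁻¹ := by
    rw [halpha, zpow_neg, hAdef, ← pow_mul, mul_comm n 2, ← zpow_natCast]
    push_cast
    rfl
  unfold fpoly at h1 h2 h3
  rw [hF, hL] at h1 h2 h3
  rw [hlog, hlog2, hz1, hz2, hF]
  exact cubic_roots_log_approx hA hb (sub_eq_zero.1 h1) (sub_eq_zero.1 h2) (sub_eq_zero.1 h3)
    h31 h12
end

section
/- Let n ≥ 10 and let (x,y) ∈ ℤ² with |y| ≥ 2 satisfy (x − F_n·y)(x − L_n·y)·x − y³ = ±1. Then min over i ∈ {1,2,3} of |x − r_i·y| is at most 2·α^5·|y|^{−2}·α^{−2n}. -/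
open Real

theorem alpha_pow_eq (n : ℕ) :
    alpha ^ n = ((lucas n : ℝ) + Real.sqrt 5 * (Nat.fib n : ℝ)) / 2 := by
  induction n using Nat.twoStepInduction with
  | zero => simp [lucas]
  | one => simp [lucas, alpha]
  | more k h0 h1 =>
    have hk : alpha ^ (k + 2) = alpha ^ (k + 1) + alpha ^ k := by
      linear_combination alpha ^ k * alpha_sq
    rw [hk, h0, h1, Nat.fib_add_two, lucas]
    push_cast
    ring

theorem lucas_eq (n : ℕ) : lucas n = 2 * (Nat.fib (n + 1) : ℤ) - Nat.fib n := by
  induction n using Nat.twoStepInduction with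
  | zero => simp [lucas]
  | one => simp [lucas]
  | more k h0 h1 =>
    rw [lucas, h0, h1, Nat.fib_add_two (n := k + 1), Nat.fib_add_two (n := k)]
    push_cast
    ring

theorem lucas_sq (n : ℕ) : lucas n ^ 2 = 5 * (Nat.fib n : ℤ) ^ 2 + 4 * (-1) ^ n := by
  rw [lucas_eq]
  induction n with
  | zero => simp
  | succ k ih =>
    rw [Nat.fib_add_two (n := k)]
    push_cast
    rw [pow_succ (-1 : ℤ) k]
    linear_combination -ih

theorem lucas_pos (n : ℕ) : 0 < lucas n := by
  induction n using Nat.twoStepInduction with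
  | zero => simp [lucas]
  | one => simp [lucas]
  | more k h0 h1 => rw [lucas]; positivity

theorem lucas_bounds {n : ℕ} (hn : 10 ≤ n) :
    2.23 * (Nat.fib n : ℝ) ≤ lucas n ∧ (lucas n : ℝ) ≤ 2.24 * Nat.fib n := by
  have hF : (55 : ℝ) ≤ Nat.fib n := by
    have : Nat.fib 10 ≤ Nat.fib n := Nat.fib_mono hn
    exact_mod_cast this
  have hL : (0 : ℝ) < lucas n := by exact_mod_cast lucas_pos n
  have hsq : (lucas n : ℝ) ^ 2 = 5 * (Nat.fib n : ℝ) ^ 2 + 4 * (-1) ^ n := by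
    exact_mod_cast lucas_sq n
  rcases neg_one_pow_eq_or ℝ n with h | h <;> rw [h] at hsq <;>
    constructor <;> refine le_of_pow_le_pow_left₀ two_ne_zero (by positivity) ?_ <;> nlinarith

/-- Vieta's relations for three distinct roots of `(X - F)(X - L)X - 1`. -/
theorem vieta_of_distinct_roots {F L r1 r2 r3 : ℝ}
    (h1 : (r1 - F) * (r1 - L) * r1 - 1 = 0) (h2 : (r2 - F) * (r2 - L) * r2 - 1 = 0)
    (h3 : (r3 - F) * (r3 - L) * r3 - 1 = 0) (h31 : r3 ≠ r1) (h12 : r1 ≠ r2) (h32 : r3 ≠ r2) :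
    r1 + r2 + r3 = F + L ∧ r1 * r2 + r1 * r3 + r2 * r3 = F * L ∧ r1 * r2 * r3 = 1 := by
  have e12 : r1 ^ 2 + r1 * r2 + r2 ^ 2 - (F + L) * (r1 + r2) + F * L = 0 :=
    mul_left_cancel₀ (sub_ne_zero.mpr h12) (by linear_combination h1 - h2)
  have e13 : r1 ^ 2 + r1 * r3 + r3 ^ 2 - (F + L) * (r1 + r3) + F * L = 0 :=
    mul_left_cancel₀ (sub_ne_zero.mpr h31) (by linear_combination h3 - h1)
  have hs : r1 + r2 + r3 - (F + L) = 0 :=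
    mul_left_cancel₀ (sub_ne_zero.mpr h32) (by linear_combination e13 - e12)
  refine ⟨by linarith, ?_, ?_⟩
  · linear_combination (r1 + r2) * hs - e12
  · linear_combination h1 - r1 * e12 + r1 * r2 * hs

/-- The two gaps between consecutive roots are comparable to `F`. -/
theorem root_gaps {F L r1 r2 r3 : ℝ} (hF : 55 ≤ F) (hL : 2.23 * F ≤ L)
    (h2 : (r2 - F) * (r2 - L) * r2 - 1 = 0) (h3 : (r3 - F) * (r3 - L) * r3 - 1 = 0)
    (h31 : r3 < r1) (h12 : r1 < r2)
    (hsum : r1 + r2 + r3 = F + L) (hprod : r1 * r2 * r3 = 1) :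
    0.9 * F ≤ r1 - r3 ∧ 1.23 * F ≤ r2 - r1 := by
  have hr3 : 0 < r3 := by
    by_contra! h
    have := mul_nonneg_of_nonpos_of_nonpos (a := r3 - F) (b := r3 - L) (by linarith) (by linarith)
    nlinarith
  have hr2 : L ≤ r2 := by
    by_contra! h
    have hFr : F < r2 := by linarith
    have := mul_pos (mul_pos (sub_pos.mpr hFr) (sub_pos.mpr h)) (by linarith : 0 < r2)
    nlinarith
  have hr2' : r2 - L ≤ 0.1 := by
    by_contra! h
    have h1 : 1 ≤ (r2 - F) * (r2 - L) := by nlinarith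
    nlinarith
  refine ⟨le_of_pow_le_pow_left₀ two_ne_zero (by linarith) ?_, by linarith⟩
  have h13 : r1 * r3 ≤ 0.01 := by
    have := mul_pos (hr3.trans h31) hr3
    nlinarith
  have hs : F - 0.1 ≤ r1 + r3 := by linarith
  have : (F - 0.1) ^ 2 ≤ (r1 + r3) ^ 2 := pow_le_pow_left₀ (by linarith) hs 2
  nlinarith

/-- If `|a|` is at most `|b|` and `|c|` and `|abc| = 1`, then `a` is small compared to the
differences `b - a` and `c - a`. -/
theorem abs_mul_sub_mul_sub_le {a b c : ℝ} (hab : |a| ≤ |b|) (hac : |a| ≤ |c|)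
    (h : |a * b * c| = 1) : |a| * (|b - a| * |c - a|) ≤ 4 := by
  have hb : |b - a| ≤ 2 * |b| := (abs_sub b a).trans (by linarith)
  have hc : |c - a| ≤ 2 * |c| := (abs_sub c a).trans (by linarith)
  calc |a| * (|b - a| * |c - a|) ≤ |a| * ((2 * |b|) * (2 * |c|)) := by gcongr
    _ = 4 * |a * b * c| := by rw [abs_mul, abs_mul]; ring
    _ = 4 := by rw [h]; norm_num

/-- The smallest of three linear forms with product `±1` is bounded in terms of the root gaps. -/
theorem min_abs_linear_forms_le {x y r1 r2 r3 : ℝ} (h31 : r3 < r1) (h12 : r1 < r2)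
    (h : |(x - r1 * y) * (x - r2 * y) * (x - r3 * y)| = 1) :
    min (min |x - r1 * y| |x - r2 * y|) |x - r3 * y| * ((r1 - r3) * (r2 - r1) * y ^ 2) ≤ 4 := by
  have hd (s t : ℝ) : |(x - s * y) - (x - t * y)| = |t - s| * |y| := by
    rw [← abs_mul]; congr 1; ring
  have p31 : 0 < r1 - r3 := sub_pos.mpr h31
  have p12 : 0 < r2 - r1 := sub_pos.mpr h12
  have p32 : 0 < r2 - r3 := by linarith
  have key {m D : ℝ} (hm : 0 ≤ m) (hD : (r1 - r3) * (r2 - r1) ≤ D)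
      (hmD : m * (D * y ^ 2) ≤ 4) : m * ((r1 - r3) * (r2 - r1) * y ^ 2) ≤ 4 :=
    le_trans (by gcongr) hmD
  have hy : |y| ^ 2 = y ^ 2 := sq_abs y
  have hmin : ∀ m, m = min (min |x - r1 * y| |x - r2 * y|) |x - r3 * y| →
      m * ((r1 - r3) * (r2 - r1) * y ^ 2) ≤ 4 := by
    intro m hm
    have m1 : m ≤ |x - r1 * y| := hm ▸ (min_le_left _ _).trans (min_le_left _ _)
    have m2 : m ≤ |x - r2 * y| := hm ▸ (min_le_left _ _).trans (min_le_right _ _)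
    have m3 : m ≤ |x - r3 * y| := hm ▸ min_le_right _ _
    have hcases : m = |x - r1 * y| ∨ m = |x - r2 * y| ∨ m = |x - r3 * y| := by
      rcases min_choice (min |x - r1 * y| |x - r2 * y|) |x - r3 * y| with e | e
      · rcases min_choice |x - r1 * y| |x - r2 * y| with e' | e'
        · exact Or.inl (by rw [hm, e, e'])
        · exact Or.inr (Or.inl (by rw [hm, e, e']))
      · exact Or.inr (Or.inr (by rw [hm, e]))
    rcases hcases with e | e | e
    · have := abs_mul_sub_mul_sub_le (e ▸ m2) (e ▸ m3) h
      rw [hd, hd, abs_sub_comm r1 r2, abs_of_pos p12, abs_of_pos p31, ← e] at this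
      refine key (e ▸ abs_nonneg _) le_rfl ?_
      rw [← hy]
      linarith
    · have := abs_mul_sub_mul_sub_le (e ▸ m1) (e ▸ m3) (by rw [← h]; congr 1; ring)
      rw [hd, hd, abs_of_pos p12, abs_of_pos p32, ← e] at this
      refine key (D := (r2 - r3) * (r2 - r1)) (e ▸ abs_nonneg _) (by gcongr) ?_
      rw [← hy]
      linarith
    · have := abs_mul_sub_mul_sub_le (e ▸ m1) (e ▸ m2) (by rw [← h]; congr 1; ring)
      rw [hd, hd, abs_sub_comm r3 r1, abs_sub_comm r3 r2, abs_of_pos p31, abs_of_pos p32, ← e]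
        at this
      refine key (D := (r1 - r3) * (r2 - r3)) (e ▸ abs_nonneg _) (by gcongr) ?_
      rw [← hy]
      linarith
  exact hmin _ rfl

theorem beta_min_upper_bound (n : ℕ) (hn : 10 ≤ n) (x y : ℤ) (hy : 2 ≤ |y|)
    (heq : (x - (Nat.fib n : ℤ) * y) * (x - lucas n * y) * x - y ^ 3 = 1 ∨
      (x - (Nat.fib n : ℤ) * y) * (x - lucas n * y) * x - y ^ 3 = -1)
    (r1 r2 r3 : ℝ)
    (h1 : fpoly n r1 = 0) (h2 : fpoly n r2 = 0) (h3 : fpoly n r3 = 0)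
    (h31 : r3 < r1) (h12 : r1 < r2) :
    min (min |(x : ℝ) - r1 * (y : ℝ)| |(x : ℝ) - r2 * (y : ℝ)|) |(x : ℝ) - r3 * (y : ℝ)|
      ≤ 2 * alpha ^ 5 * |(y : ℝ)| ^ (-2 : ℤ) * alpha ^ (-(2 * n : ℤ)) := by
  have hF : (55 : ℝ) ≤ Nat.fib n := by
    have : Nat.fib 10 ≤ Nat.fib n := Nat.fib_mono hn
    exact_mod_cast this
  obtain ⟨hL, hL'⟩ := lucas_bounds hn
  have hA := alpha_pow_eq n
  unfold fpoly at h1 h2 h3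
  have heq' : |((x : ℝ) - Nat.fib n * y) * (x - lucas n * y) * x - y ^ 3| = 1 := by
    rcases heq with h | h
    · have h' : ((x : ℝ) - Nat.fib n * y) * (x - lucas n * y) * x - y ^ 3 = 1 := by
        exact_mod_cast h
      rw [h', abs_one]
    · have h' : ((x : ℝ) - Nat.fib n * y) * (x - lucas n * y) * x - y ^ 3 = -1 := by
        exact_mod_cast h
      rw [h', abs_neg, abs_one]
  generalize (Nat.fib n : ℝ) = F at *
  generalize (lucas n : ℝ) = L at *
  obtain ⟨hsum, hpair, hprod⟩ :=
    vieta_of_distinct_roots h1 h2 h3 h31.ne h12.ne (h31.trans h12).ne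
  obtain ⟨g1, g2⟩ := root_gaps hF hL h2 h3 h31 h12 hsum hprod
  have hforms : |((x : ℝ) - r1 * y) * (x - r2 * y) * (x - r3 * y)| = 1 := by
    rw [← heq']
    congr 1
    linear_combination (-(x : ℝ) ^ 2 * y) * hsum + (x * (y : ℝ) ^ 2) * hpair - (y : ℝ) ^ 3 * hprod
  have hmin := min_abs_linear_forms_le h31 h12 hforms
  have hs : Real.sqrt 5 ≤ 2.237 := Real.sqrt_le_iff.mpr (by norm_num)
  have hs' : 2.236 ≤ Real.sqrt 5 := Real.le_sqrt_of_sq_le (by norm_num)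
  have ha : 1.618 ≤ alpha := by unfold alpha; linarith
  have ha5 : 11.09 ≤ alpha ^ 5 := by
    have : alpha ^ 5 = 5 * alpha + 3 := by
      linear_combination (alpha ^ 3 + alpha ^ 2 + 2 * alpha + 3) * alpha_sq
    linarith
  have hpos : 0 < alpha ^ n := pow_pos (by linarith) n
  have hAF : alpha ^ n ≤ 2.2385 * F := by rw [hA]; nlinarith
  have hA2 : (alpha ^ n) ^ 2 ≤ 5.02 * F ^ 2 := by
    have := pow_le_pow_left₀ hpos.le hAF 2
    nlinarith
  have hD : 1.107 * F ^ 2 ≤ (r1 - r3) * (r2 - r1) := by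
    have := mul_le_mul g1 g2 (by linarith) (by linarith)
    linarith
  have hDA : 4 * (alpha ^ n) ^ 2 ≤ 2 * alpha ^ 5 * ((r1 - r3) * (r2 - r1)) := by
    have := mul_le_mul ha5 hD (by positivity) (by positivity)
    nlinarith
  have hDpos : 0 < (r1 - r3) * (r2 - r1) := mul_pos (by linarith) (by linarith)
  have hy0 : (0 : ℝ) < (y : ℝ) ^ 2 := by
    have hyne : y ≠ 0 := by rintro rfl; simp at hy
    positivity
  have hrhs : 2 * alpha ^ 5 * |(y : ℝ)| ^ (-2 : ℤ) * alpha ^ (-(2 * n : ℤ)) =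
      2 * alpha ^ 5 / ((y : ℝ) ^ 2 * (alpha ^ n) ^ 2) := by
    have e1 : |(y : ℝ)| ^ (-2 : ℤ) = ((y : ℝ) ^ 2)⁻¹ := by
      rw [zpow_neg, ← sq_abs]; norm_cast
    have e2 : alpha ^ (-(2 * n : ℤ)) = ((alpha ^ n) ^ 2)⁻¹ := by
      rw [zpow_neg, ← pow_mul, mul_comm n 2]; norm_cast
    rw [e1, e2, div_eq_mul_inv, mul_inv, mul_assoc]
  rw [hrhs]
  calc _ ≤ 4 / ((r1 - r3) * (r2 - r1) * (y : ℝ) ^ 2) :=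
        (le_div_iff₀ (mul_pos hDpos hy0)).mpr hmin
    _ ≤ _ := by
      rw [div_le_div_iff₀ (mul_pos hDpos hy0) (mul_pos hy0 (pow_pos hpos 2))]
      linarith [mul_le_mul_of_nonneg_left hDA hy0.le]
end

section
/- Let n ≥ 10 and let (x,y) ∈ ℤ² with |y| ≥ 2 satisfy (x − F_n·y)(x − L_n·y)·x − y³ = ±1, and let j ∈ {1,2,3} be an index at which |x − r_i·y| is minimal. Then for each i ∈ {1,2,3} with i ≠ j one has |x − r_i·y| ≥ |y|·α^{n−3}. -/
open Real

theorem lucas_succ_eq_fib_add_fib (k : ℕ) :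
    lucas (k + 1) = (Nat.fib k : ℤ) + Nat.fib (k + 2) := by
  induction k using Nat.twoStepInduction with
  | zero => simp [lucas]
  | one => simp [lucas, Nat.fib_add_two]
  | more k ih₀ ih₁ =>
    have h : lucas (k + 2 + 1) = lucas (k + 1 + 1) + lucas (k + 1) := rfl
    rw [h, ih₀, ih₁]
    have h₁ : Nat.fib (k + 2) = Nat.fib k + Nat.fib (k + 1) := Nat.fib_add_two
    have h₂ : Nat.fib (k + 2 + 2) = Nat.fib (k + 2) + Nat.fib (k + 1 + 2) := Nat.fib_add_two
    omega

theorem two_mul_fib_le_lucas (k : ℕ) :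
    2 * (Nat.fib (k + 2) : ℤ) ≤ lucas (k + 2) := by
  have h := lucas_succ_eq_fib_add_fib (k + 1)
  have h₁ : Nat.fib (k + 1 + 2) = Nat.fib (k + 1) + Nat.fib (k + 2) := Nat.fib_add_two
  have h₂ : Nat.fib (k + 2) = Nat.fib k + Nat.fib (k + 1) := Nat.fib_add_two
  have h₃ : Nat.fib k ≤ Nat.fib (k + 1) := Nat.fib_le_fib_succ
  rw [show lucas (k + 2) = lucas (k + 1 + 1) from rfl, h]
  omega

theorem alpha_pow_le_fib (k : ℕ) : alpha ^ k ≤ (Nat.fib (k + 2) : ℝ) := by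
  induction k using Nat.twoStepInduction with
  | zero => simp
  | one =>
    have h : Real.sqrt 5 ≤ 3 := Real.sqrt_le_iff.2 (by norm_num)
    simp only [alpha, pow_one, Nat.fib_add_two, Nat.fib_one, zero_add]
    norm_num
    linarith
  | more k ih₀ ih₁ =>
    rw [pow_add, alpha_sq, Nat.fib_add_two (n := k + 2)]
    push_cast
    rw [pow_succ] at ih₁
    linarith

/-- A real number with `(r - F) (r - L) r = 1` lies within distance one of `0`, `F` or `L`. -/
theorem near_of_mul_eq_one {F L r : ℝ} (h : (r - F) * (r - L) * r = 1) :
    |r| ≤ 1 ∨ |r - F| ≤ 1 ∨ |r - L| ≤ 1 := by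
  by_contra! hc
  obtain ⟨h₁, h₂, h₃⟩ := hc
  have h' : |r - F| * |r - L| * |r| = 1 := by rw [← abs_mul, ← abs_mul, h, abs_one]
  have : 1 < |r - F| * |r - L| * |r| :=
    one_lt_mul_of_lt_of_le (one_lt_mul_of_lt_of_le h₂ h₃.le) h₁.le
  linarith

/-- Symmetric relation satisfied by two distinct solutions of `(r - F) (r - L) r = 1`. -/
theorem quadratic_relation {F L a b : ℝ} (ha : (a - F) * (a - L) * a = 1)
    (hb : (b - F) * (b - L) * b = 1) (hab : a ≠ b) :
    a ^ 2 + a * b + b ^ 2 - (F + L) * (a + b) + F * L = 0 := by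
  apply mul_left_cancel₀ (sub_ne_zero.2 hab)
  linear_combination ha - hb

/-- Distinct solutions of `(r - F) (r - L) r = 1` are at distance at least `F - 2`. -/
theorem le_abs_sub_of_roots {F L a b : ℝ} (hF : 55 ≤ F) (hL : 2 * F ≤ L)
    (ha : (a - F) * (a - L) * a = 1) (hb : (b - F) * (b - L) * b = 1) (hab : a ≠ b) :
    F - 2 ≤ |a - b| := by
  have hq := quadratic_relation ha hb hab
  have hprod : ∀ u v : ℝ, |u| ≤ 1 → |v| ≤ 1 →
      0 ≤ u ^ 2 + u * v + v ^ 2 ∧ u ^ 2 + u * v + v ^ 2 ≤ 3 := by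
    intro u v hu hv
    rw [abs_le] at hu hv
    constructor
    · nlinarith [sq_nonneg (u + v), sq_nonneg u, sq_nonneg v]
    · nlinarith
  rcases near_of_mul_eq_one ha with h₁ | h₁ | h₁ <;>
    rcases near_of_mul_eq_one hb with h₂ | h₂ | h₂
  · exfalso
    obtain ⟨h₃, h₄⟩ := hprod _ _ h₁ h₂
    rw [abs_le] at h₁ h₂
    nlinarith
  · rw [abs_le] at h₁ h₂
    exact le_abs.2 (Or.inr (by linarith))
  · rw [abs_le] at h₁ h₂
    exact le_abs.2 (Or.inr (by linarith))
  · rw [abs_le] at h₁ h₂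
    exact le_abs.2 (Or.inl (by linarith))
  · exfalso
    obtain ⟨h₃, h₄⟩ := hprod _ _ h₁ h₂
    rw [abs_le] at h₁ h₂
    have hq' : (a - F) ^ 2 + (a - F) * (b - F) + (b - F) ^ 2
        + (2 * F - L) * ((a - F) + (b - F)) - F * (L - F) = 0 := by
      linear_combination hq
    nlinarith
  · rw [abs_le] at h₁ h₂
    exact le_abs.2 (Or.inr (by linarith))
  · rw [abs_le] at h₁ h₂
    exact le_abs.2 (Or.inl (by linarith))
  · rw [abs_le] at h₁ h₂
    exact le_abs.2 (Or.inl (by linarith))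
  · exfalso
    obtain ⟨h₃, h₄⟩ := hprod _ _ h₁ h₂
    rw [abs_le] at h₁ h₂
    have hq' : (a - L) ^ 2 + (a - L) * (b - L) + (b - L) ^ 2
        + (2 * L - F) * ((a - L) + (b - L)) + L * (L - F) = 0 := by
      linear_combination hq
    nlinarith

/-- Factorization of the binary cubic form over three distinct solutions of
`(r - F) (r - L) r = 1`. -/
theorem prod_sub_mul_eq {F L a b c : ℝ} (ha : (a - F) * (a - L) * a = 1)
    (hb : (b - F) * (b - L) * b = 1) (hc : (c - F) * (c - L) * c = 1)
    (hab : a ≠ b) (hac : a ≠ c) (hbc : b ≠ c) (x y : ℝ) :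
    (x - a * y) * (x - b * y) * (x - c * y) = (x - F * y) * (x - L * y) * x - y ^ 3 := by
  have h₁ := quadratic_relation ha hb hab
  have h₂ := quadratic_relation ha hc hac
  have hs : a + b + c = F + L := by
    apply mul_left_cancel₀ (sub_ne_zero.2 hbc)
    linear_combination h₁ - h₂
  obtain rfl : c = F + L - a - b := by linarith
  linear_combination (-x * y ^ 2 + a * y ^ 3) * h₁ - y ^ 3 * ha

theorem beta_other_lower_bound (n : ℕ) (hn : 10 ≤ n) (x y : ℤ) (hy : 2 ≤ |y|)
    (heq : (x - (Nat.fib n : ℤ) * y) * (x - lucas n * y) * x - y ^ 3 = 1 ∨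
      (x - (Nat.fib n : ℤ) * y) * (x - lucas n * y) * x - y ^ 3 = -1)
    (r : Fin 3 → ℝ)
    (hroot : ∀ i, fpoly n (r i) = 0)
    (hord : r 2 < r 0 ∧ r 0 < r 1)
    (j : Fin 3)
    (hmin : ∀ i, |(x : ℝ) - r j * (y : ℝ)| ≤ |(x : ℝ) - r i * (y : ℝ)|) :
    ∀ i, i ≠ j → |(y : ℝ)| * alpha ^ ((n : ℤ) - 3) ≤ |(x : ℝ) - r i * (y : ℝ)| := by
  have hn₂ : n - 2 + 2 = n := by omega
  have hF : (55 : ℝ) ≤ Nat.fib n := by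
    exact_mod_cast (show 55 ≤ Nat.fib n from Nat.fib_mono hn)
  have hL : 2 * (Nat.fib n : ℝ) ≤ lucas n := by
    have h := two_mul_fib_le_lucas (n - 2)
    rw [hn₂] at h
    exact_mod_cast h
  have hα : alpha ^ ((n : ℤ) - 3) ≤ (Nat.fib n : ℝ) - 3 := by
    obtain ⟨k, rfl⟩ : ∃ k, n = k + 3 := ⟨n - 3, by omega⟩
    rw [show ((k + 3 : ℕ) : ℤ) - 3 = (k : ℤ) by push_cast; ring, zpow_natCast]
    have h₁ : Nat.fib (k + 1 + 2) = Nat.fib (k + 1) + Nat.fib (k + 2) := Nat.fib_add_two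
    have h₂ : 21 ≤ Nat.fib (k + 1) := Nat.fib_mono (show 8 ≤ k + 1 by omega)
    have h₃ : Nat.fib (k + 2) + 3 ≤ Nat.fib (k + 3) := by
      rw [show k + 3 = k + 1 + 2 from rfl]
      omega
    have h₄ : (Nat.fib (k + 2) : ℝ) + 3 ≤ Nat.fib (k + 3) := by exact_mod_cast h₃
    linarith [alpha_pow_le_fib k]
  have hr : ∀ i, (r i - Nat.fib n) * (r i - lucas n) * r i = 1 :=
    fun i => sub_eq_zero.1 (hroot i)
  have hinj : Function.Injective r := by
    intro a b hab
    fin_cases a <;> fin_cases b <;> first | rfl | (simp at hab; linarith [hord.1, hord.2])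
  have hy' : (2 : ℝ) ≤ |(y : ℝ)| := by exact_mod_cast hy
  have hprod : ∏ i, |(x : ℝ) - r i * y| = 1 := by
    rw [← Finset.abs_prod, Fin.prod_univ_three,
      prod_sub_mul_eq (hr 0) (hr 1) (hr 2) hord.2.ne hord.1.ne' (hord.1.trans hord.2).ne']
    rcases heq with h | h
    · rw [abs_eq_abs.2 (Or.inl (by exact_mod_cast h : _ = (1 : ℝ))), abs_one]
    · rw [abs_eq_abs.2 (Or.inr (by exact_mod_cast h : _ = -(1 : ℝ))), abs_one]
  have hj : |(x : ℝ) - r j * y| ≤ 1 := by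
    by_contra! h
    rw [Fin.prod_univ_three] at hprod
    have : 1 < |(x : ℝ) - r 0 * y| * |(x : ℝ) - r 1 * y| * |(x : ℝ) - r 2 * y| :=
      one_lt_mul_of_lt_of_le (one_lt_mul_of_lt_of_le (h.trans_le (hmin 0))
        (h.trans_le (hmin 1)).le) (h.trans_le (hmin 2)).le
    linarith
  intro i hij
  have hgap := le_abs_sub_of_roots hF hL (hr i) (hr j) (hinj.ne hij)
  have htri : |r i - r j| * |(y : ℝ)| ≤ |(x : ℝ) - r j * y| + |(x : ℝ) - r i * y| := by
    rw [← abs_mul, show (r i - r j) * (y : ℝ) = (x - r j * y) - (x - r i * y) by ring]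
    exact abs_sub _ _
  nlinarith [mul_le_mul_of_nonneg_right hgap (abs_nonneg (y : ℝ)),
    mul_le_mul_of_nonneg_left hα (abs_nonneg (y : ℝ))]
end

section
/- Let n ≥ 10, let (x,y) ∈ ℤ² with |y| ≥ 2 satisfy (x − F_n·y)(x − L_n·y)·x − y³ = ±1, let j ∈ {1,2,3} be an index at which |x − r_i·y| is minimal, and let {k,l} = {1,2,3} \ {j}. If b_1, b_2 ∈ ℤ satisfy log|x − r_i·y| = b_1·log|r_i| + b_2·log|r_i − F_n| for both i = k and i = l, then max{|b_1|, |b_2|} ≤ (7/n)·max{log|x − r_k·y|, log|x − r_l·y|}. -/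
open Real

theorem two_mul_fib_le_lucas_le (m : ℕ) :
    (2 * (Nat.fib (m + 2) : ℤ) ≤ lucas (m + 2) ∧ lucas (m + 2) ≤ 3 * (Nat.fib (m + 2) : ℤ)) ∧
      2 * (Nat.fib (m + 3) : ℤ) ≤ lucas (m + 3) ∧
        lucas (m + 3) ≤ 3 * (Nat.fib (m + 3) : ℤ) := by
  induction m with
  | zero => simp [lucas, Nat.fib_add_two]
  | succ k ih =>
    obtain ⟨⟨h1, h2⟩, h3, h4⟩ := ih
    have hL : lucas (k + 4) = lucas (k + 3) + lucas (k + 2) := rfl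
    have hF : (Nat.fib (k + 4) : ℤ) = Nat.fib (k + 2) + Nat.fib (k + 3) := by
      exact_mod_cast Nat.fib_add_two (n := k + 2)
    refine ⟨⟨h3, h4⟩, ?_, ?_⟩
    · rw [show k + 1 + 3 = k + 4 from rfl, hL, hF]; linarith
    · rw [show k + 1 + 3 = k + 4 from rfl, hL, hF]; linarith

theorem two_pow_le_fib_sub_one_sq (m : ℕ) :
    (55 : ℝ) ≤ Nat.fib (m + 10) ∧ (2 : ℝ) ^ (m + 10) ≤ ((Nat.fib (m + 10) : ℝ) - 1) ^ 2 := by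
  induction m with
  | zero =>
    have : Nat.fib 10 = 55 := by decide
    norm_num [this]
  | succ k ih =>
    obtain ⟨h1, h2⟩ := ih
    have hF : 3 * Nat.fib (k + 10) ≤ 2 * Nat.fib (k + 11) := by
      have e1 : Nat.fib (k + 11) = Nat.fib (k + 9) + Nat.fib (k + 10) := Nat.fib_add_two
      have e2 : Nat.fib (k + 10) = Nat.fib (k + 8) + Nat.fib (k + 9) := Nat.fib_add_two
      have e3 : Nat.fib (k + 8) ≤ Nat.fib (k + 9) := Nat.fib_le_fib_succ
      omega
    have hF' : 3 * (Nat.fib (k + 10) : ℝ) ≤ 2 * Nat.fib (k + 11) := by exact_mod_cast hF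
    rw [show k + 1 + 10 = k + 11 from rfl, pow_succ]
    refine ⟨by linarith, ?_⟩
    nlinarith [pow_succ (2 : ℝ) (k + 10)]

/-- A monic cubic with three distinct roots is the product of its linear factors, in
homogeneous form. -/
theorem homogeneous_cubic_eq_prod {F L r₀ r₁ r₂ : ℝ}
    (h₀ : (r₀ - F) * (r₀ - L) * r₀ - 1 = 0) (h₁ : (r₁ - F) * (r₁ - L) * r₁ - 1 = 0)
    (h₂ : (r₂ - F) * (r₂ - L) * r₂ - 1 = 0) (h₀₁ : r₀ ≠ r₁) (h₀₂ : r₀ ≠ r₂) (h₁₂ : r₁ ≠ r₂)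
    (X Y : ℝ) :
    (X - r₀ * Y) * (X - r₁ * Y) * (X - r₂ * Y) = (X - F * Y) * (X - L * Y) * X - Y ^ 3 := by
  have e1 : r₀ ^ 2 + r₀ * r₁ + r₁ ^ 2 - (F + L) * (r₀ + r₁) + F * L = 0 :=
    mul_left_cancel₀ (sub_ne_zero.2 h₀₁) (by linear_combination h₀ - h₁)
  have e2 : r₀ ^ 2 + r₀ * r₂ + r₂ ^ 2 - (F + L) * (r₀ + r₂) + F * L = 0 :=
    mul_left_cancel₀ (sub_ne_zero.2 h₀₂) (by linear_combination h₀ - h₂)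
  have s1 : r₀ + r₁ + r₂ - (F + L) = 0 :=
    mul_left_cancel₀ (sub_ne_zero.2 h₁₂) (by linear_combination e1 - e2)
  have s2 : r₀ * r₁ + r₀ * r₂ + r₁ * r₂ = F * L := by
    linear_combination (r₀ + r₁) * s1 - e1
  have s3 : r₀ * r₁ * r₂ = 1 := by
    linear_combination h₀ - r₀ ^ 2 * s1 + r₀ * s2
  linear_combination (-X ^ 2 * Y) * s1 + X * Y ^ 2 * s2 - Y ^ 3 * s3

/-- Cramer's rule estimate for a two by two linear system. -/
theorem abs_le_of_two_by_two {A B C D s t M c N : ℝ} (hc : 0 < c) (hN : 0 < N)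
    (hcN : 3 * N ≤ 14 * c)
    (h1 : |s * A + t * B| ≤ M) (h2 : |s * C + t * D| ≤ M)
    (hdet : 3 * c ^ 2 ≤ |A * D - B * C|)
    (hAC : |A| + |C| ≤ 9 / 2 * c) (hBD : |B| + |D| ≤ 9 / 2 * c) :
    max |s| |t| ≤ 7 / N * M := by
  have hM : 0 ≤ M := (abs_nonneg _).trans h1
  have key : ∀ w P Q : ℝ, |P| + |Q| ≤ 9 / 2 * c →
      w * (A * D - B * C) = (s * A + t * B) * Q - (s * C + t * D) * P → |w| ≤ 7 / N * M := by
    intro w P Q hPQ hw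
    have h : |w| * (3 * c ^ 2) ≤ M * (9 / 2 * c) :=
      calc |w| * (3 * c ^ 2) ≤ |w| * |A * D - B * C| := by gcongr
        _ = |(s * A + t * B) * Q - (s * C + t * D) * P| := by rw [← abs_mul, hw]
        _ ≤ |s * A + t * B| * |Q| + |s * C + t * D| * |P| := by
          rw [← abs_mul, ← abs_mul]; exact abs_sub _ _
        _ ≤ M * |Q| + M * |P| := by gcongr
        _ = M * (|P| + |Q|) := by ring
        _ ≤ M * (9 / 2 * c) := by gcongr
    have h' : |w| * c ≤ M * (3 / 2) := by
      refine le_of_mul_le_mul_right ?_ hc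
      nlinarith
    rw [div_mul_eq_mul_div, le_div_iff₀ hN]
    nlinarith [abs_nonneg w]
  exact max_le (key s B D hBD (by ring)) (key t (-A) (-C) (by simpa using hAC) (by ring))

/-- The three real roots of `fpoly n` are close to `0`, `F_n` and `L_n`. -/
theorem root_bounds {F L r₀ r₁ r₂ : ℝ} (hF : 55 ≤ F) (hL : 2 * F ≤ L)
    (h₂₀ : r₂ < r₀) (h₀₁ : r₀ < r₁)
    (hprod : ∀ X : ℝ, (X - r₀) * (X - r₁) * (X - r₂) = (X - F) * (X - L) * X - 1) :
    (0 < r₂ ∧ r₂ < 1) ∧ (F - 1 < r₀ ∧ r₀ < F) ∧ (L < r₁ ∧ r₁ < L + 1) := by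
  have pos : ∀ X : ℝ, 0 < (X - F) * (X - L) * X - 1 → (r₂ < X ∧ X < r₀) ∨ r₁ < X := by
    intro X hX
    rw [← hprod] at hX
    by_contra! hcon
    obtain ⟨hc1, hc2⟩ := hcon
    rcases le_or_gt X r₂ with h | h
    · have := mul_nonneg (mul_nonneg (show 0 ≤ r₀ - X by linarith)
        (show 0 ≤ r₁ - X by linarith)) (show 0 ≤ r₂ - X by linarith)
      nlinarith
    · have := mul_nonneg (mul_nonneg (show 0 ≤ X - r₀ by linarith [hc1 h])
        (show 0 ≤ r₁ - X by linarith)) (show 0 ≤ X - r₂ by linarith)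
      nlinarith
  have neg : ∀ X : ℝ, (X - F) * (X - L) * X - 1 < 0 → X < r₂ ∨ (r₀ < X ∧ X < r₁) := by
    intro X hX
    rw [← hprod] at hX
    by_contra! hcon
    obtain ⟨hc1, hc2⟩ := hcon
    rcases le_or_gt X r₀ with h | h
    · have := mul_nonneg (mul_nonneg (show 0 ≤ r₀ - X by linarith)
        (show 0 ≤ r₁ - X by linarith)) (show 0 ≤ X - r₂ by linarith)
      nlinarith
    · have := mul_nonneg (mul_nonneg (show 0 ≤ X - r₀ by linarith)
        (show 0 ≤ X - r₁ by linarith [hc2 h])) (show 0 ≤ X - r₂ by linarith)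
      nlinarith
  have p1 := pos 1 (by nlinarith)
  have p2 := pos (F - 1) (by nlinarith)
  have p3 := pos (L + 1) (by nlinarith)
  have n1 := neg 0 (by linarith)
  have n2 := neg F (by linarith)
  have n3 := neg L (by linarith)
  grind

/-- Size estimates for the two by two minors of a matrix with rows `(A i, B i)` summing to zero,
with the sign pattern of the logarithms of the units `r i` and `r i - F`. -/
theorem two_by_two_minor_bounds {A B : Fin 3 → ℝ} {c : ℝ} (hc : 0 < c)
    (hA : A 0 + A 1 + A 2 = 0) (hB : B 0 + B 1 + B 2 = 0)
    (hA0 : c ≤ A 0 ∧ A 0 ≤ 3 / 2 * c) (hA1 : c ≤ A 1 ∧ A 1 ≤ 3 / 2 * c)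
    (hB1 : c ≤ B 1 ∧ B 1 ≤ 3 / 2 * c) (hB2 : c ≤ B 2 ∧ B 2 ≤ 3 / 2 * c)
    {k l : Fin 3} (hkl : k ≠ l) :
    3 * c ^ 2 ≤ |A k * B l - B k * A l| ∧ |A k| + |A l| ≤ 9 / 2 * c ∧
      |B k| + |B l| ≤ 9 / 2 * c := by
  obtain ⟨hA0, hA0'⟩ := hA0
  obtain ⟨hA1, hA1'⟩ := hA1
  obtain ⟨hB1, hB1'⟩ := hB1
  obtain ⟨hB2, hB2'⟩ := hB2
  have hA2 : A 2 = -(A 0 + A 1) := by linarith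
  have hB0 : B 0 = -(B 1 + B 2) := by linarith
  have hdet : 3 * c ^ 2 ≤ A 0 * B 1 + A 1 * (B 1 + B 2) := by
    nlinarith [mul_le_mul hA0 hB1 hc.le (hc.le.trans hA0),
      mul_le_mul hA1 hB1 hc.le (hc.le.trans hA1), mul_le_mul hA1 hB2 hc.le (hc.le.trans hA1)]
  have a0 : |A 0| = A 0 := abs_of_pos (by linarith)
  have a1 : |A 1| = A 1 := abs_of_pos (by linarith)
  have a2 : |A 2| = A 0 + A 1 := by rw [hA2, abs_neg, abs_of_pos (by linarith)]
  have b0 : |B 0| = B 1 + B 2 := by rw [hB0, abs_neg, abs_of_pos (by linarith)]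
  have b1 : |B 1| = B 1 := abs_of_pos (by linarith)
  have b2 : |B 2| = B 2 := abs_of_pos (by linarith)
  refine ⟨hdet.trans ?_, ?_⟩
  · rw [le_abs]
    fin_cases k <;> fin_cases l <;> simp only [Fin.zero_eta, Fin.mk_one, Fin.reduceFinMk] at * <;>
      first
      | exact absurd rfl hkl
      | (rw [hA2, hB0]; left; linarith)
      | (rw [hA2, hB0]; right; linarith)
      | (rw [hA2]; left; linarith)
      | (rw [hA2]; right; linarith)
      | (rw [hB0]; left; linarith)
      | (rw [hB0]; right; linarith)
  · fin_cases k <;> fin_cases l <;>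
      simp only [Fin.zero_eta, Fin.mk_one, Fin.reduceFinMk, a0, a1, a2, b0, b1, b2] at * <;>
      first
      | exact absurd rfl hkl
      | (constructor <;> linarith)

theorem add_add_eq_of_pairwise_ne {R : Type*} [AddCommMonoid R] (f : Fin 3 → R) {j k l : Fin 3}
    (hjk : j ≠ k) (hjl : j ≠ l) (hkl : k ≠ l) : f j + f k + f l = f 0 + f 1 + f 2 := by
  have huniv : ({j, k, l} : Finset (Fin 3)) = Finset.univ := by
    rw [← Finset.card_eq_iff_eq_univ, Finset.card_eq_three.2 ⟨j, k, l, hjk, hjl, hkl, rfl⟩,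
      Fintype.card_fin]
  rw [← Fin.sum_univ_three, ← huniv, Finset.sum_insert (by simp [hjk, hjl]),
    Finset.sum_pair hkl, add_assoc]

theorem exponent_bounds (n : ℕ) (hn : 10 ≤ n) (x y : ℤ) (hy : 2 ≤ |y|)
    (heq : (x - (Nat.fib n : ℤ) * y) * (x - lucas n * y) * x - y ^ 3 = 1 ∨
      (x - (Nat.fib n : ℤ) * y) * (x - lucas n * y) * x - y ^ 3 = -1)
    (r : Fin 3 → ℝ)
    (hroot : ∀ i, fpoly n (r i) = 0)
    (hord : r 2 < r 0 ∧ r 0 < r 1)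
    (j k l : Fin 3) (hjk : j ≠ k) (hjl : j ≠ l) (hkl : k ≠ l)
    (hmin : ∀ i, |(x : ℝ) - r j * (y : ℝ)| ≤ |(x : ℝ) - r i * (y : ℝ)|)
    (b1 b2 : ℤ)
    (hbk : Real.log |(x : ℝ) - r k * (y : ℝ)| =
      (b1 : ℝ) * Real.log |r k| + (b2 : ℝ) * Real.log |r k - (Nat.fib n : ℝ)|)
    (hbl : Real.log |(x : ℝ) - r l * (y : ℝ)| =
      (b1 : ℝ) * Real.log |r l| + (b2 : ℝ) * Real.log |r l - (Nat.fib n : ℝ)|) :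
    max (|b1| : ℝ) (|b2| : ℝ) ≤ (7 / (n : ℝ)) *
      max (Real.log |(x : ℝ) - r k * (y : ℝ)|) (Real.log |(x : ℝ) - r l * (y : ℝ)|) := by
  obtain ⟨h20, h01⟩ := hord
  have hF55 : (55 : ℝ) ≤ Nat.fib n ∧ (2 : ℝ) ^ n ≤ ((Nat.fib n : ℝ) - 1) ^ 2 := by
    have := two_pow_le_fib_sub_one_sq (n - 10)
    rwa [Nat.sub_add_cancel hn] at this
  have hLF : 2 * (Nat.fib n : ℝ) ≤ lucas n ∧ (lucas n : ℝ) ≤ 3 * Nat.fib n := by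
    have := (two_mul_fib_le_lucas_le (n - 2)).1
    rw [Nat.sub_add_cancel (by omega)] at this
    exact_mod_cast this
  have hvieta := homogeneous_cubic_eq_prod (hroot 0) (hroot 1) (hroot 2) h01.ne h20.ne'
    (h20.trans h01).ne'
  have heqR : ((x : ℝ) - r 0 * y) * (x - r 1 * y) * (x - r 2 * y) = 1 ∨
      ((x : ℝ) - r 0 * y) * (x - r 1 * y) * (x - r 2 * y) = -1 := by
    rw [hvieta]; exact_mod_cast heq
  have hprod := fun X ↦ hvieta X 1
  simp only [mul_one, one_pow] at hprod
  generalize (Nat.fib n : ℝ) = F at *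
  generalize (lucas n : ℝ) = L at *
  obtain ⟨hF, hFpow⟩ := hF55
  obtain ⟨hL2, hL3⟩ := hLF
  obtain ⟨⟨hr2, hr2'⟩, ⟨hr0, hr0'⟩, ⟨hr1, hr1'⟩⟩ := root_bounds hF hL2 h20 h01 hprod
  have log_prod : ∀ p q s : ℝ, |p * q * s| = 1 →
      Real.log |p| + Real.log |q| + Real.log |s| = 0 := by
    intro p q s h
    have hp : p ≠ 0 := by rintro rfl; simp at h
    have hq : q ≠ 0 := by rintro rfl; simp at h
    have hs : s ≠ 0 := by rintro rfl; simp at h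
    rw [← Real.log_mul (by positivity) (by positivity),
      ← Real.log_mul (by positivity) (by positivity), ← abs_mul, ← abs_mul, h, Real.log_one]
  have habs : |((x : ℝ) - r 0 * y) * (x - r 1 * y) * (x - r 2 * y)| = 1 := by
    rcases heqR with h | h <;> simp [h]
  have hsum := log_prod _ _ _ habs
  have hA : Real.log |r 0| + Real.log |r 1| + Real.log |r 2| = 0 := by
    apply log_prod
    rw [show r 0 * r 1 * r 2 = 1 by linear_combination -hprod 0, abs_one]
  have hB : Real.log |r 0 - F| + Real.log |r 1 - F| + Real.log |r 2 - F| = 0 := by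
    apply log_prod
    rw [show (r 0 - F) * (r 1 - F) * (r 2 - F) = 1 by linear_combination -hprod F, abs_one]
  have hpos : ∀ i, 0 < |(x : ℝ) - r i * y| := by
    intro i
    rw [abs_pos]
    intro h
    have hi : i = 0 ∨ i = 1 ∨ i = 2 := by omega
    rcases hi with rfl | rfl | rfl <;> simp [h] at habs
  have hlogmin : ∀ i, Real.log |(x : ℝ) - r j * y| ≤ Real.log |(x : ℝ) - r i * y| :=
    fun i ↦ Real.log_le_log (hpos j) (hmin i)
  set c := Real.log (F - 1) with hc_def
  have hcn : 3 * (n : ℝ) ≤ 14 * c := by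
    have h := Real.log_le_log (by positivity) hFpow
    rw [Real.log_pow, Real.log_pow] at h
    push_cast at h
    have := Real.log_two_gt_d9
    have hn0 : (0 : ℝ) ≤ n := by positivity
    nlinarith
  have hn0 : (0 : ℝ) < n := by exact_mod_cast (by omega : 0 < n)
  have hc : 0 < c := by linarith
  have hrange : ∀ t : ℝ, F - 1 ≤ |t| → |t| ≤ L + 1 → c ≤ Real.log |t| ∧
      Real.log |t| ≤ 3 / 2 * c := by
    intro t h1 h2
    refine ⟨Real.log_le_log (by linarith) h1, ?_⟩
    have h3 : |t| ^ 2 ≤ (F - 1) ^ 3 := by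
      have : |t| ^ 2 ≤ (4 * (F - 1)) ^ 2 := by gcongr; linarith
      nlinarith [sq_nonneg (F - 1)]
    have h4 := Real.log_le_log (pow_pos (by linarith) 2) h3
    rw [Real.log_pow, Real.log_pow] at h4
    push_cast at h4
    linarith
  obtain ⟨hdet, hAkl, hBkl⟩ := two_by_two_minor_bounds (A := fun i ↦ Real.log |r i|)
    (B := fun i ↦ Real.log |r i - F|) hc hA hB
    (hrange _ (by rw [abs_of_pos] <;> linarith) (by rw [abs_of_pos] <;> linarith))
    (hrange _ (by rw [abs_of_pos] <;> linarith) (by rw [abs_of_pos] <;> linarith))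
    (hrange _ (by rw [abs_of_pos] <;> linarith) (by rw [abs_of_pos] <;> linarith))
    (hrange _ (by rw [abs_of_neg] <;> linarith) (by rw [abs_of_neg] <;> linarith)) hkl
  have hsum' : Real.log |(x : ℝ) - r j * y| + Real.log |(x : ℝ) - r k * y| +
      Real.log |(x : ℝ) - r l * y| = 0 := by
    rw [← hsum]
    exact add_add_eq_of_pairwise_ne (fun i ↦ Real.log |(x : ℝ) - r i * y|) hjk hjl hkl
  have hkM : |(Real.log |(x : ℝ) - r k * y|)| ≤
      max (Real.log |(x : ℝ) - r k * y|) (Real.log |(x : ℝ) - r l * y|) := by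
    have h1 := hlogmin k
    have h2 := hlogmin l
    rw [abs_le']
    exact ⟨le_max_left _ _, le_max_of_le_right (by linarith)⟩
  have hlM : |(Real.log |(x : ℝ) - r l * y|)| ≤
      max (Real.log |(x : ℝ) - r k * y|) (Real.log |(x : ℝ) - r l * y|) := by
    have h1 := hlogmin k
    have h2 := hlogmin l
    rw [abs_le']
    exact ⟨le_max_right _ _, le_max_of_le_left (by linarith)⟩
  rw [hbk, hbl] at hkM hlM ⊢
  exact abs_le_of_two_by_two hc hn0 hcn hkM hlM hdet hAkl hBkl
end

section
/- The real numbers log α, log √5 and log(√5 − 1) are linearly independent over ℚ; that is, if q_1, q_2, q_3 ∈ ℚ satisfy q_1·log α + q_2·log √5 + q_3·log(√5 − 1) = 0, then q_1 = q_2 = q_3 = 0. -/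
open Real

/-- A nonzero integer power of the golden ratio is irrational. -/
theorem irrational_goldenRatio_zpow {a : ℤ} (ha : a ≠ 0) : Irrational (goldenRatio ^ a) := by
  have key (n : ℕ) (hn : n ≠ 0) : Irrational (goldenRatio ^ n) := by
    obtain ⟨m, rfl⟩ := Nat.exists_eq_succ_of_ne_zero hn
    rw [Nat.succ_eq_add_one, ← goldenRatio_mul_fib_succ_add_fib]
    exact (goldenRatio_irrational.mul_natCast (Nat.fib_pos.2 m.succ_pos).ne').add_natCast _
  obtain ⟨n, rfl | rfl⟩ := a.eq_nat_or_neg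
  · simpa using key n (by simpa using ha)
  · simpa using key n (by simpa using ha)

/-- The numbers `2` and `5` are multiplicatively independent. -/
theorem eq_zero_of_two_zpow_mul_five_zpow_eq_one {b c : ℤ} (h : (2 : ℚ) ^ b * 5 ^ c = 1) :
    b = 0 ∧ c = 0 := by
  have h2 : (2 : ℚ) ^ b ≠ 0 := by positivity
  have h5 : (5 : ℚ) ^ c ≠ 0 := by positivity
  have : Fact (Nat.Prime 5) := ⟨by norm_num⟩
  have val2 : padicValRat 2 (5 : ℚ) = 0 := by
    exact_mod_cast congrArg (Nat.cast : ℕ → ℤ)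
      (padicValNat.eq_zero_of_not_dvd (p := 2) (n := 5) (by norm_num))
  have val5 : padicValRat 5 (2 : ℚ) = 0 := by
    exact_mod_cast congrArg (Nat.cast : ℕ → ℤ)
      (padicValNat.eq_zero_of_not_dvd (p := 5) (n := 2) (by norm_num))
  have val22 : padicValRat 2 (2 : ℚ) = 1 := padicValRat.self (p := 2) (by norm_num)
  have val55 : padicValRat 5 (5 : ℚ) = 1 := padicValRat.self (p := 5) (by norm_num)
  have e2 := congrArg (padicValRat 2) h
  have e5 := congrArg (padicValRat 5) h
  rw [padicValRat.mul h2 h5, padicValRat.zpow, padicValRat.zpow,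
    padicValRat.one] at e2 e5
  rw [val2, val22] at e2
  rw [val5, val55] at e5
  constructor <;> linarith

/-- The logarithms of the golden ratio, `2` and `5` are linearly independent over `ℤ`. -/
theorem int_log_goldenRatio_two_five {a b c : ℤ}
    (h : (a : ℝ) * log goldenRatio + b * log 2 + c * log 5 = 0) : a = 0 ∧ b = 0 ∧ c = 0 := by
  have hφ := goldenRatio_pos
  have hprod : goldenRatio ^ a * ((2 : ℝ) ^ b * 5 ^ c) = 1 := by
    refine eq_one_of_pos_of_log_eq_zero (by positivity) ?_
    rw [log_mul (by positivity) (by positivity), log_mul (by positivity) (by positivity),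
      log_zpow, log_zpow, log_zpow]
    linarith
  have ha : a = 0 := by
    by_contra ha
    refine irrational_goldenRatio_zpow ha ⟨((2 : ℚ) ^ b * 5 ^ c)⁻¹, ?_⟩
    push_cast
    exact (eq_inv_of_mul_eq_one_left hprod).symm
  subst ha
  refine ⟨rfl, eq_zero_of_two_zpow_mul_five_zpow_eq_one ?_⟩
  rw [zpow_zero, one_mul] at hprod
  exact Rat.cast_injective (α := ℝ) (by push_cast; exact hprod)

/-- The logarithms of the golden ratio, `2` and `5` are linearly independent over `ℚ`. -/
theorem rat_log_goldenRatio_two_five {a b c : ℚ}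
    (h : (a : ℝ) * log goldenRatio + b * log 2 + c * log 5 = 0) : a = 0 ∧ b = 0 ∧ c = 0 := by
  have key : ((a.num * b.den * c.den : ℤ) : ℝ) * log goldenRatio +
      ((b.num * a.den * c.den : ℤ) : ℝ) * log 2 + ((c.num * a.den * b.den : ℤ) : ℝ) * log 5
        = 0 := by
    have cast_num (q : ℚ) : (q.num : ℝ) = q * q.den := by exact_mod_cast (Rat.mul_den_eq_num q).symm
    push_cast
    rw [cast_num a, cast_num b, cast_num c]
    linear_combination (a.den * b.den * c.den : ℝ) * h
  simpa using int_log_goldenRatio_two_five key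

theorem log_sqrt_five_sub_one : log (√5 - 1) = log 2 - log goldenRatio := by
  rw [← log_div two_ne_zero goldenRatio_ne_zero]
  congr 1
  rw [eq_div_iff goldenRatio_ne_zero, goldenRatio]
  linear_combination (1 / 2 : ℝ) * Real.sq_sqrt (show (0 : ℝ) ≤ 5 by norm_num)

theorem log_linear_independence (q1 q2 q3 : ℚ)
    (h : (q1 : ℝ) * Real.log alpha + (q2 : ℝ) * Real.log (Real.sqrt 5) +
      (q3 : ℝ) * Real.log (Real.sqrt 5 - 1) = 0) :
    q1 = 0 ∧ q2 = 0 ∧ q3 = 0 := by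
  change (q1 : ℝ) * log goldenRatio + _ + _ = 0 at h
  rw [log_sqrt_five_sub_one, log_sqrt (by norm_num)] at h
  obtain ⟨h1, h3, h2⟩ := rat_log_goldenRatio_two_five (a := q1 - q3) (b := q3) (c := q2 / 2) (by
    push_cast
    linear_combination h)
  refine ⟨?_, ?_, h3⟩ <;> linarith
end
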